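/- Assume conditions (L) (for some δ > 0) and (N) hold, g(s,τ) ≤ g'(0,τ) s for all s ≥ 0 and τ ∈ X, χ(0) < 0, and let λ > 0 be the leftmost positive zero of χ; assume further that there is ε > 0 such that ν := λ + ε is in the domain of χ with χ(ν) > 0. Then the convolution equation (17) has at least one solution φ satisfying δ e^{λt}(1 − e^{εt}) ≤ φ(t) ≤ δ e^{λt} for all t ≤ 0 and 0 ≤ φ(t) ≤ δ e^{λt} for all t ∈ ℝ (in particular φ(−∞) = 0). Moreover, if G'(0) := C g'(0,τ0)/(1 − g̃'(0)) is finite then sup_{s∈ℝ} φ(s) < ζ2; and if G(s) = s has exactly two solutions 0 and κ on [0,∞) with κ globally attracting for the map G : (0,ζ2] → (0,ζ2], then lim_{t→+∞} φ(t) = κ. -/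

import Mathlib

open MeasureTheory Filter Topology Set

theorem ContinuousLinearMap.det_one_add_pos_of_norm_lt_one {E : Type*} [NormedAddCommGroup E]
    [NormedSpace ℝ E] [FiniteDimensional ℝ E] {A : E →L[ℝ] E} (hA : ‖A‖ < 1) :
    0 < (1 + A).det := by
  have hne : ∀ t ∈ Icc (0:ℝ) 1, (1 + t • A).det ≠ 0 := by
    intro t ht h0
    have hker : LinearMap.ker ((1 + t • A : E →L[ℝ] E) : E →ₗ[ℝ] E) ≠ ⊥ := by
      intro h
      have := LinearMap.isUnit_iff_ker_eq_bot _ |>.2 h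
      have := (LinearMap.isUnit_iff_isUnit_det _).1 this
      exact this.ne_zero h0
    obtain ⟨x, hx, hx0⟩ := Submodule.exists_mem_ne_zero_of_ne_bot hker
    have hx1 : x + t • A x = 0 := by simpa using hx
    have hn : ‖x‖ = t * ‖A x‖ := by
      have := congrArg norm (eq_neg_of_add_eq_zero_left hx1)
      rwa [norm_neg, norm_smul, Real.norm_of_nonneg ht.1] at this
    have h1 := A.le_opNorm x
    have h2 : 0 < ‖x‖ := norm_pos_iff.2 hx0
    nlinarith [ht.1, ht.2, norm_nonneg (A x)]
  have hcont : Continuous fun t : ℝ => (1 + t • A).det :=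
    ContinuousLinearMap.continuous_det.comp (by fun_prop)
  by_contra! hle
  obtain ⟨t, ht, h0⟩ := intermediate_value_Icc' (zero_le_one' ℝ) hcont.continuousOn
    (show (0:ℝ) ∈ Icc _ _ from ⟨by simpa using hle, by simp [ContinuousLinearMap.det]⟩)
  exact hne t ht h0

/-- The value at `1` of the polynomial `t ↦ det (1 + t A)` is a combination, with coefficients
independent of `A`, of its values at finitely many points close to `0`. -/
theorem ContinuousLinearMap.exists_det_one_add_eq_sum {E : Type*} [NormedAddCommGroup E]
    [NormedSpace ℝ E] [FiniteDimensional ℝ E] {r : ℝ} (hr : 0 < r) :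
    ∃ (s : Finset ℕ) (t c : ℕ → ℝ), (∀ i, t i ∈ Ioc 0 r) ∧
      ∀ A : E →L[ℝ] E, (1 + A).det = ∑ i ∈ s, c i * (1 + t i • A).det := by
  classical
  let n := Module.finrank ℝ E
  let t : ℕ → ℝ := fun i => r / (i + 1)
  have ht : Function.Injective t := by
    intro i j hij
    have : (i:ℝ) + 1 = j + 1 := by
      have h1 : (i:ℝ) + 1 ≠ 0 := by positivity
      have h2 : (j:ℝ) + 1 ≠ 0 := by positivity
      simp only [t] at hij
      field_simp at hij
      linarith
    exact_mod_cast add_right_cancel this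
  refine ⟨Finset.range (n + 1), t,
    fun i => (Lagrange.basis (Finset.range (n + 1)) t i).eval 1, fun i => ⟨by positivity, ?_⟩, ?_⟩
  · exact div_le_self hr.le (by linarith [Nat.cast_nonneg (α := ℝ) i])
  intro A
  let b := Module.finBasis ℝ E
  let M := LinearMap.toMatrix b b (A : E →ₗ[ℝ] E)
  let p : Polynomial ℝ :=
    Matrix.det ((Polynomial.X : Polynomial ℝ) • M.map Polynomial.C
      + (1 : Matrix (Fin n) (Fin n) ℝ).map Polynomial.C)
  have hp : ∀ x : ℝ, p.eval x = (1 + x • A).det := by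
    intro x
    have h1 : (1 + x • A).det = (x • M + 1).det := by
      rw [ContinuousLinearMap.det, ← LinearMap.det_toMatrix b]
      congr 1
      have : ((1 + x • A : E →L[ℝ] E) : E →ₗ[ℝ] E) = LinearMap.id + x • (A : E →ₗ[ℝ] E) := rfl
      rw [this, map_add, map_smul, LinearMap.toMatrix_id, add_comm]
    rw [h1, ← Polynomial.coe_evalRingHom, RingHom.map_det]
    congr 1
    ext i j
    rcases eq_or_ne i j with rfl | hij
    · simp [mul_comm x]
    · simp [hij, mul_comm x]
  have hdeg : p.degree < (Finset.range (n + 1)).card := by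
    have h := Polynomial.natDegree_det_X_add_C_le M 1
    rw [Fintype.card_fin] at h
    rw [Finset.card_range]
    exact lt_of_le_of_lt Polynomial.degree_le_natDegree (by exact_mod_cast Nat.lt_succ_of_le h)
  have := Lagrange.eq_interpolate (v := t) ht.injOn hdeg
  have h1 := congrArg (Polynomial.eval 1) this
  rw [hp, one_smul] at h1
  rw [h1, Lagrange.interpolate_apply, Polynomial.eval_finsetSum]
  refine Finset.sum_congr rfl fun i _ => ?_
  simp [hp, mul_comm]

theorem integral_det_fderiv_of_eq_on_sphere {E : Type*} [NormedAddCommGroup E]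
    [NormedSpace ℝ E] [FiniteDimensional ℝ E] [MeasurableSpace E] [BorelSpace E]
    (ν : Measure E) [ν.IsAddHaarMeasure] {f : E → E} (hf : ContDiff ℝ 1 f) {R : ℝ} (hR : 0 < R)
    (hfs : ∀ x, ‖x‖ = R → f x = x) (hfb : ∀ x, ‖x‖ ≤ R → ‖f x‖ ≤ R) :
    ∫ x in Metric.ball 0 R, (fderiv ℝ f x).det ∂ν = ν.real (Metric.ball 0 R) := by
  have hdiff : Differentiable ℝ f := hf.differentiable (by norm_num)
  have hfd : Continuous (fderiv ℝ f) := hf.continuous_fderiv (by norm_num)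
  obtain ⟨L, hL⟩ := (isCompact_closedBall (0:E) R).exists_bound_of_continuousOn
    (f := fun x => fderiv ℝ f x - 1) (by fun_prop)
  have hL0 : 0 ≤ L := (norm_nonneg _).trans (hL 0 (by simp [hR.le]))
  have hLip : ∀ x ∈ Metric.closedBall (0:E) R, ∀ y ∈ Metric.closedBall (0:E) R,
      ‖(f y - y) - (f x - x)‖ ≤ L * ‖y - x‖ := by
    intro x hx y hy
    exact (convex_closedBall (0:E) R).norm_image_sub_le_of_norm_hasFDerivWithin_le
      (f := fun z => f z - z) (f' := fun x => fderiv ℝ f x - 1)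
      (fun z hz => ((hdiff z).hasFDerivAt.sub (hasFDerivAt_id z)).hasFDerivWithinAt) hL hx hy
  have key : ∀ t ∈ Ioc (0:ℝ) (1 / (L + 1)),
      ∫ x in Metric.ball 0 R, (1 + t • (fderiv ℝ f x - 1)).det ∂ν = ν.real (Metric.ball 0 R) := by
    intro t ht
    have htL : t * L < 1 := by
      have : t * (L + 1) ≤ 1 := by
        have := ht.2; rwa [le_div_iff₀ (by positivity)] at this
      nlinarith [ht.1]
    have ht1 : t ≤ 1 := ht.2.trans (by rw [div_le_one (by positivity)]; linarith)
    let h : E → E := fun x => x + t • (f x - x)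
    have hhc : ContDiff ℝ 1 h := by fun_prop
    have hh' : ∀ x, HasFDerivAt h (1 + t • (fderiv ℝ f x - 1)) x := fun x =>
      (hasFDerivAt_id x).add (((hdiff x).hasFDerivAt.sub (hasFDerivAt_id x)).const_smul t)
    have hdet : ∀ x ∈ Metric.closedBall (0:E) R, 0 < (1 + t • (fderiv ℝ f x - 1)).det := by
      intro x hx
      apply ContinuousLinearMap.det_one_add_pos_of_norm_lt_one
      rw [norm_smul, Real.norm_of_nonneg ht.1.le]
      exact (mul_le_mul_of_nonneg_left (hL x hx) ht.1.le).trans_lt htL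
    have hinj : InjOn h (Metric.closedBall (0:E) R) := by
      intro x hx y hy hxy
      have h1 : y - x = -(t • ((f y - y) - (f x - x))) := by
        have : y + t • (f y - y) - (x + t • (f x - x)) = 0 := sub_eq_zero.2 hxy.symm
        rw [smul_sub, eq_neg_iff_add_eq_zero, ← this]; abel
      have h2 : ‖y - x‖ ≤ t * (L * ‖y - x‖) := by
        conv_lhs => rw [h1, norm_neg, norm_smul, Real.norm_of_nonneg ht.1.le]
        exact mul_le_mul_of_nonneg_left (hLip x hx y hy) ht.1.le
      by_contra hne
      have : 0 < ‖y - x‖ := norm_pos_iff.2 (sub_ne_zero.2 (Ne.symm hne))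
      nlinarith
    have hmaps : ∀ x, ‖x‖ ≤ R → ‖h x‖ ≤ R := by
      intro x hx
      have : h x = (1 - t) • x + t • f x := by
        simp only [h, smul_sub, sub_smul, one_smul]; abel
      rw [this]
      refine (norm_add_le _ _).trans ?_
      rw [norm_smul, norm_smul, Real.norm_of_nonneg ht.1.le,
        Real.norm_of_nonneg (sub_nonneg.2 ht1)]
      nlinarith [hfb x hx, ht.1]
    have hopen : IsOpen (h '' Metric.ball 0 R) := by
      rw [isOpen_iff_mem_nhds]
      rintro _ ⟨x, hx, rfl⟩
      have hs : HasStrictFDerivAt h (1 + t • (fderiv ℝ f x - 1)) x :=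
        hhc.contDiffAt.hasStrictFDerivAt' (hh' x) (by norm_num)
      have hsurj : (1 + t • (fderiv ℝ f x - 1)).range = ⊤ := by
        have hu := (LinearMap.isUnit_iff_isUnit_det
          ((1 + t • (fderiv ℝ f x - 1) : E →L[ℝ] E) : E →ₗ[ℝ] E)).2
          (hdet x (Metric.ball_subset_closedBall hx)).ne'.isUnit
        exact (LinearMap.isUnit_iff_range_eq_top _).1 hu
      rw [← hs.map_nhds_eq_of_surj hsurj]
      exact image_mem_map (Metric.isOpen_ball.mem_nhds hx)
    have himage : h '' Metric.ball 0 R = Metric.ball 0 R := by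
      apply Subset.antisymm
      · rw [← interior_closedBall (0:E) hR.ne']
        refine interior_maximal ?_ (by rwa [interior_closedBall (0:E) hR.ne'])
        rintro _ ⟨x, hx, rfl⟩
        rw [interior_closedBall (0:E) hR.ne', mem_ball_zero_iff] at hx
        exact mem_closedBall_zero_iff.2 (hmaps x hx.le)
      · have hcl : closure (h '' Metric.ball 0 R) ⊆ h '' Metric.closedBall 0 R :=
          closure_minimal (image_mono Metric.ball_subset_closedBall)
            ((isCompact_closedBall (0:E) R).image hhc.continuous).isClosed
        have hin : ∀ y ∈ h '' Metric.closedBall 0 R, y ∈ Metric.ball (0:E) R →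
            y ∈ h '' Metric.ball 0 R := by
          rintro _ ⟨x, hx, rfl⟩ hy
          rcases (mem_closedBall_zero_iff.1 hx).lt_or_eq with hlt | heq
          · exact ⟨x, mem_ball_zero_iff.2 hlt, rfl⟩
          · exfalso
            have : h x = x := by simp [h, hfs x heq]
            rw [this, mem_ball_zero_iff] at hy
            exact hy.ne heq
        have hne : (Metric.ball (0:E) R ∩ h '' Metric.ball 0 R).Nonempty := by
          have h0 : (0:E) ∈ Metric.ball (0:E) R := by simpa using hR
          refine ⟨h 0, ?_, mem_image_of_mem _ h0⟩
          have : h '' Metric.ball 0 R ⊆ interior (Metric.closedBall 0 R) := by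
            refine interior_maximal ?_ hopen
            rintro _ ⟨x, hx, rfl⟩
            exact mem_closedBall_zero_iff.2 (hmaps x (mem_ball_zero_iff.1 hx).le)
          rw [interior_closedBall (0:E) hR.ne'] at this
          exact this (mem_image_of_mem _ h0)
        exact (convex_ball (0:E) R).isPreconnected.subset_of_closure_inter_subset hopen hne
          fun y hy => hin y (hcl hy.1) hy.2
    have hcv := integral_image_eq_integral_abs_det_fderiv_smul ν Metric.isOpen_ball.measurableSet
      (fun x _ => (hh' x).hasFDerivWithinAt) (hinj.mono Metric.ball_subset_closedBall)
      (fun _ => (1:ℝ))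
    rw [himage] at hcv
    simp only [smul_eq_mul, mul_one, integral_const, measureReal_restrict_apply_univ] at hcv
    rw [hcv]
    refine setIntegral_congr_fun Metric.isOpen_ball.measurableSet fun x hx => ?_
    exact (abs_of_pos (hdet x (Metric.ball_subset_closedBall hx))).symm
  obtain ⟨s, t, c, ht, hsum⟩ := ContinuousLinearMap.exists_det_one_add_eq_sum (E := E)
    (r := 1 / (L + 1)) (by positivity)
  have h1 : ∀ x, (fderiv ℝ f x).det
      = ∑ i ∈ s, c i * (1 + t i • (fderiv ℝ f x - 1)).det := by
    intro x
    rw [← hsum]; congr 1; abel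
  have hc1 : ∑ i ∈ s, c i = 1 := by
    have := hsum 0
    simp [ContinuousLinearMap.det] at this
    exact this.symm
  simp_rw [h1]
  rw [integral_finsetSum]
  · simp_rw [integral_const_mul, key _ (ht _), ← Finset.sum_mul, hc1, one_mul]
  · intro i _
    refine Integrable.const_mul ?_ _
    have hc : Continuous fun x => (1 + t i • (fderiv ℝ f x - 1)).det :=
      ContinuousLinearMap.continuous_det.comp (by fun_prop)
    exact (hc.continuousOn.integrableOn_compact (isCompact_closedBall (0:E) R)).mono_set
      Metric.ball_subset_closedBall
theorem ContDiff.exists_fixedPt_of_eq_zero_off_ball {E : Type*} [NormedAddCommGroup E]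
    [InnerProductSpace ℝ E] [FiniteDimensional ℝ E] {F : E → E} (hF : ContDiff ℝ 1 F) {R : ℝ}
    (hR : 0 < R) (hF0 : ∀ x, R ≤ ‖x‖ → F x = 0) : ∃ x, F x = x := by
  borelize E
  by_contra! hne
  have hH : ∀ x, x - F x ≠ 0 := fun x h => hne x (sub_eq_zero.1 h).symm
  have hHn : ∀ x, ‖x - F x‖ ≠ 0 := fun x => norm_ne_zero_iff.2 (hH x)
  let r : E → E := fun x => (R / ‖x - F x‖) • (x - F x)
  have hHc : ContDiff ℝ 1 fun x => x - F x := contDiff_id.sub hF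
  have hr : ContDiff ℝ 1 r := (contDiff_const.div (hHc.norm ℝ hH) hHn).smul hHc
  have hrn : ∀ x, ‖r x‖ = R := by
    intro x
    simp only [r]
    rw [norm_smul, norm_div, norm_norm, Real.norm_of_nonneg hR.le, div_mul_cancel₀ _ (hHn x)]
  have hrs : ∀ x, ‖x‖ = R → r x = x := by
    intro x hx
    simp [r, hF0 x hx.ge, hx, hR.ne']
  have hdet : ∀ x, (fderiv ℝ r x).det = 0 := by
    intro x
    by_contra h
    have hu := (LinearMap.isUnit_iff_isUnit_det (fderiv ℝ r x : E →ₗ[ℝ] E)).2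
      (isUnit_iff_ne_zero.2 h)
    have hsurj := LinearMap.range_eq_top.1 ((LinearMap.isUnit_iff_range_eq_top _).1 hu)
    obtain ⟨v, hv⟩ := hsurj (r x)
    have hd : HasFDerivAt r (fderiv ℝ r x) x :=
      (hr.differentiable (by norm_num) x).hasFDerivAt
    have h2 := hd.norm_sq
    have h3 : (fun y => ‖r y‖ ^ 2) = fun _ => R ^ 2 := by ext y; rw [hrn]
    rw [h3] at h2
    have h4 := congrArg (fun T => T v) (h2.unique (hasFDerivAt_const (R ^ 2) x))
    have hv' : fderiv ℝ r x v = r x := hv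
    simp [hv', hrn, hR.ne'] at h4
  have hint := integral_det_fderiv_of_eq_on_sphere (Measure.addHaar : Measure E) hr hR hrs
    fun x _ => (hrn x).le
  simp only [hdet, integral_zero] at hint
  have hpos : 0 < (Measure.addHaar : Measure E).real (Metric.ball 0 R) :=
    ENNReal.toReal_pos (Metric.measure_ball_pos _ _ hR).ne' measure_ball_lt_top.ne
  exact hpos.ne hint

/-- **Brouwer's fixed point theorem** for bounded continuous self-maps of a Euclidean space. -/
theorem Continuous.exists_fixedPt_of_bounded {E : Type*} [NormedAddCommGroup E]
    [InnerProductSpace ℝ E] [FiniteDimensional ℝ E] {F : E → E} (hF : Continuous F)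
    (hb : ∃ R, ∀ x, ‖F x‖ ≤ R) : ∃ x, F x = x := by
  obtain ⟨R₀, hR₀⟩ := hb
  have hR₀0 : 0 ≤ R₀ := (norm_nonneg _).trans (hR₀ 0)
  let R := R₀ + 1
  have hR : 0 < R := by positivity
  let χ : ContDiffBump (0 : E) := ⟨R, R + 1, hR, by linarith⟩
  have hχ1 : ∀ x : E, ‖x‖ ≤ R → χ x = 1 := fun x hx =>
    χ.one_of_mem_closedBall (mem_closedBall_zero_iff.2 hx)
  have hχ0 : ∀ x : E, R + 1 ≤ ‖x‖ → χ x = 0 := fun x hx =>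
    χ.zero_of_le_dist (by simpa using hx)
  let F₁ : E → E := fun x => χ x • F x
  have hF₁ : Continuous F₁ := χ.continuous.smul hF
  have hfix₁ : ∀ x, F₁ x = x → F x = x := by
    intro x hx
    have hle : ‖x‖ ≤ R := by
      rw [← hx, norm_smul, Real.norm_of_nonneg χ.nonneg]
      have := mul_le_mul (χ.le_one (x := x)) (hR₀ x) (norm_nonneg _) zero_le_one
      linarith
    simpa only [F₁, hχ1 x hle, one_smul] using hx
  by_contra! hne
  have hne₁ : ∀ x, F₁ x ≠ x := fun x hx => hne x (hfix₁ x hx)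
  have hF₁0 : ∀ x : E, R + 1 ≤ ‖x‖ → F₁ x = 0 := fun x hx => by simp [F₁, hχ0 x hx]
  obtain ⟨c, hc, hcF⟩ : ∃ c > 0, ∀ x, c ≤ ‖F₁ x - x‖ := by
    obtain ⟨x₀, -, hx₀⟩ := (isCompact_closedBall (0:E) (R + 1)).exists_isMinOn
      ⟨0, by simp; linarith⟩ (f := fun x => ‖F₁ x - x‖) (by fun_prop)
    refine ⟨min ‖F₁ x₀ - x₀‖ (R + 1),
      lt_min (norm_pos_iff.2 (sub_ne_zero.2 (hne₁ x₀))) (by positivity), fun x => ?_⟩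
    rcases le_total ‖x‖ (R + 1) with h | h
    · exact (min_le_left _ _).trans (hx₀ (mem_closedBall_zero_iff.2 h))
    · rw [hF₁0 x h, zero_sub, norm_neg]
      exact (min_le_right _ _).trans h
  have hcomp : HasCompactSupport F₁ :=
    HasCompactSupport.intro (isCompact_closedBall (0:E) (R + 1)) fun x hx =>
      hF₁0 x (by simpa using (not_le.1 fun h => hx (mem_closedBall_zero_iff.2 h)).le)
  obtain ⟨g, hg, hgF⟩ := (hcomp.uniformContinuous_of_continuous hF₁).exists_contDiff_dist_le hc
  let ψ : ContDiffBump (0 : E) := ⟨R + 1, R + 2, by linarith, by linarith⟩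
  obtain ⟨x, hx⟩ := ContDiff.exists_fixedPt_of_eq_zero_off_ball (F := fun x => ψ x • g x)
    (ψ.contDiff.smul (hg.of_le (by norm_num))) (R := R + 2) (by linarith)
    fun x hx => by
      have : ψ x = 0 := ψ.zero_of_le_dist (by simpa using hx)
      simp [this]
  have hclose : ‖F₁ x - ψ x • g x‖ < c := by
    have h1 : ‖F₁ x - g x‖ < c := by
      rw [← dist_eq_norm, dist_comm]; exact hgF x
    rcases le_total ‖x‖ (R + 1) with h | h
    · have : ψ x = 1 := ψ.one_of_mem_closedBall (mem_closedBall_zero_iff.2 h)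
      rwa [this, one_smul]
    · rw [hF₁0 x h, zero_sub, norm_neg] at h1 ⊢
      rw [norm_smul, Real.norm_of_nonneg ψ.nonneg]
      exact (mul_le_of_le_one_left (norm_nonneg _) ψ.le_one).trans_lt h1
  rw [hx] at hclose
  exact (hcF x).not_gt hclose
theorem MeasureTheory.Integrable.tendsto_integral_abs_translate_sub {f : ℝ → ℝ}
    (hf : Integrable f) :
    Tendsto (fun h => ∫ u, |f (h + u) - f u|) (𝓝 0) (𝓝 0) := by
  have hm : MemLp f 1 volume := memLp_one_iff_integrable.2 hf
  let F : Lp ℝ 1 (volume : Measure ℝ) := hm.toLp f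
  have hfact : Fact ((1 : ENNReal) ≠ ⊤) := ⟨ENNReal.one_ne_top⟩
  have hc : Continuous fun h : ℝ => DomAddAct.mk h +ᵥ F := by
    have h1 : Continuous fun h : ℝ => (DomAddAct.mk h : ℝᵈᵃᵃ) := DomAddAct.continuous_mk
    exact h1.vadd continuous_const
  have h0 : Tendsto (fun h : ℝ => dist (DomAddAct.mk h +ᵥ F) F) (𝓝 0) (𝓝 0) := by
    have : Tendsto (fun h : ℝ => dist (DomAddAct.mk h +ᵥ F) F) (𝓝 0)
        (𝓝 (dist (DomAddAct.mk (0:ℝ) +ᵥ F) F)) := (hc.dist continuous_const).tendsto 0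
    have hz : DomAddAct.mk (0:ℝ) +ᵥ F = F := zero_vadd (ℝᵈᵃᵃ) F
    rwa [hz, dist_self] at this
  refine h0.congr fun h => ?_
  rw [dist_eq_norm, L1.norm_eq_integral_norm]
  refine integral_congr_ae ?_
  have h1 : (DomAddAct.mk h +ᵥ F : Lp ℝ 1 (volume : Measure ℝ)) =ᵐ[volume] fun u => f (h + u) := by
    rw [DomAddAct.mk_vadd_toLp h hm]
    exact MemLp.coeFn_toLp _
  filter_upwards [Lp.coeFn_sub (DomAddAct.mk h +ᵥ F) F, h1, hm.coeFn_toLp] with u h2 h3 h4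
  rw [h2, Pi.sub_apply, h3, h4, Real.norm_eq_abs]

/-- A pointwise bounded sequence of functions on `ℝ` with a common modulus of continuity has a
pointwise convergent subsequence. -/
theorem exists_subseq_tendsto_of_modulus {f : ℕ → ℝ → ℝ} {a b : ℝ} {ω : ℝ → ℝ}
    (hf : ∀ n t, f n t ∈ Icc a b) (hω : Tendsto ω (𝓝 0) (𝓝 0))
    (hmod : ∀ n t t', |f n t - f n t'| ≤ ω (t - t')) :
    ∃ (φ : ℝ → ℝ) (k : ℕ → ℕ), StrictMono k ∧ ∀ t, Tendsto (fun n => f (k n) t) atTop (𝓝 (φ t)) := by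
  have hcomp : IsCompact (univ.pi fun _ : ℚ => Icc a b) := isCompact_univ_pi fun _ => isCompact_Icc
  obtain ⟨r, -, k, hk, hlim⟩ := hcomp.tendsto_subseq (x := fun n (q : ℚ) => f n q)
    fun n q _ => hf n q
  rw [tendsto_pi_nhds] at hlim
  have hcauchy : ∀ t, CauchySeq fun n => f (k n) t := by
    intro t
    rw [Metric.cauchySeq_iff]
    intro ε hε
    obtain ⟨d, hd, hωd⟩ := Metric.tendsto_nhds_nhds.1 hω (ε / 3) (by positivity)
    obtain ⟨q, hq1, hq2⟩ := exists_rat_btwn (show t - d < t by linarith)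
    have hsmall : ω (t - q) < ε / 3 := by
      have := hωd (x := t - q) (by rw [Real.dist_eq, sub_zero, abs_lt]; constructor <;> linarith)
      rw [Real.dist_eq, sub_zero] at this
      exact (le_abs_self _).trans_lt this
    obtain ⟨N, hN⟩ := Metric.cauchySeq_iff.1 (hlim q).cauchySeq (ε / 3) (by positivity)
    refine ⟨N, fun m hm n hn => ?_⟩
    have h1 := hN m hm n hn
    simp only [Function.comp, Real.dist_eq] at h1 ⊢
    have h2 := abs_le.1 (hmod (k m) t q)
    have h3 := abs_le.1 (hmod (k n) t q)
    rw [abs_lt] at h1 ⊢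
    constructor <;> linarith
  choose φ hφ using fun t => cauchySeq_tendsto_of_complete (hcauchy t)
  exact ⟨φ, k, hk, hφ⟩

/-- Standing assumptions on a kernel `K` and a nonlinearity `g` bounded by `B`. -/
structure IsConvData {X : Type*} [MeasurableSpace X] (μ : Measure X) (K g : ℝ → X → ℝ) (B : ℝ) :
    Prop where
  measurable_kernel : Measurable fun p : ℝ × X => K p.1 p.2
  kernel_nonneg : ∀ s τ, 0 ≤ K s τ
  integrable_kernel : Integrable (fun p : ℝ × X => K p.1 p.2) ((volume : Measure ℝ).prod μ)
  integrable_slice : ∀ τ, Integrable fun s => K s τ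
  measurable_nonlin : Measurable fun p : ℝ × X => g p.1 p.2
  nonlin_nonneg : ∀ u τ, 0 ≤ u → 0 ≤ g u τ
  nonlin_le : ∀ u τ, 0 ≤ u → g u τ ≤ B
  continuousOn_nonlin : ∀ τ, ContinuousOn (fun u => g u τ) (Ici 0)

/-- The right-hand side of the convolution equation. -/
noncomputable def convOp {X : Type*} [MeasurableSpace X] (μ : Measure X) (K g : ℝ → X → ℝ)
    (φ : ℝ → ℝ) (t : ℝ) : ℝ :=
  ∫ τ, (∫ s, K s τ * g (φ (t - s)) τ) ∂μ

namespace IsConvData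

variable {X : Type*} [MeasurableSpace X] {μ : Measure X} {K g : ℝ → X → ℝ} {B : ℝ}
  {φ : ℝ → ℝ}

theorem measurable_integrand (H : IsConvData μ K g B) (hφ : Measurable φ) (t : ℝ) :
    Measurable fun p : ℝ × X => K p.1 p.2 * g (φ (t - p.1)) p.2 :=
  H.measurable_kernel.mul <| H.measurable_nonlin.comp <|
    (hφ.comp (measurable_const.sub measurable_fst)).prodMk measurable_snd

theorem integrand_nonneg (H : IsConvData μ K g B) (hφ0 : ∀ t, 0 ≤ φ t) (t s : ℝ) (τ : X) :
    0 ≤ K s τ * g (φ (t - s)) τ :=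
  mul_nonneg (H.kernel_nonneg _ _) (H.nonlin_nonneg _ _ (hφ0 _))

theorem integrand_le (H : IsConvData μ K g B) (hφ0 : ∀ t, 0 ≤ φ t) (t s : ℝ) (τ : X) :
    K s τ * g (φ (t - s)) τ ≤ K s τ * B :=
  mul_le_mul_of_nonneg_left (H.nonlin_le _ _ (hφ0 _)) (H.kernel_nonneg _ _)

theorem integrable_integrand (H : IsConvData μ K g B) (hφ : Measurable φ) (hφ0 : ∀ t, 0 ≤ φ t)
    (t : ℝ) : Integrable (fun p : ℝ × X => K p.1 p.2 * g (φ (t - p.1)) p.2)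
      ((volume : Measure ℝ).prod μ) := by
  refine (H.integrable_kernel.mul_const B).mono'
    (H.measurable_integrand hφ t).aestronglyMeasurable (Eventually.of_forall fun p => ?_)
  rw [Real.norm_of_nonneg (H.integrand_nonneg hφ0 _ _ _)]
  exact H.integrand_le hφ0 _ _ _

theorem integrable_integrand_slice (H : IsConvData μ K g B) (hφ : Measurable φ)
    (hφ0 : ∀ t, 0 ≤ φ t) (t : ℝ) (τ : X) : Integrable fun s => K s τ * g (φ (t - s)) τ := by
  refine ((H.integrable_slice τ).mul_const B).mono'
    ((H.measurable_integrand hφ t).comp measurable_prodMk_right).aestronglyMeasurable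
    (Eventually.of_forall fun s => ?_)
  rw [Real.norm_of_nonneg (H.integrand_nonneg hφ0 _ _ _)]
  exact H.integrand_le hφ0 _ _ _

theorem convOp_nonneg (H : IsConvData μ K g B) (hφ0 : ∀ t, 0 ≤ φ t) (t : ℝ) :
    0 ≤ convOp μ K g φ t :=
  integral_nonneg fun τ => integral_nonneg fun s => H.integrand_nonneg hφ0 t s τ

variable [SFinite μ]

theorem convOp_eq_integral_prod (H : IsConvData μ K g B) (hφ : Measurable φ)
    (hφ0 : ∀ t, 0 ≤ φ t) (t : ℝ) :
    convOp μ K g φ t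
      = ∫ p : ℝ × X, K p.1 p.2 * g (φ (t - p.1)) p.2 ∂(volume : Measure ℝ).prod μ :=
  (integral_prod_symm _ (H.integrable_integrand hφ hφ0 t)).symm

theorem tendsto_convOp (H : IsConvData μ K g B) {ι : Type*} {l : Filter ι}
    [l.IsCountablyGenerated] {ψ : ι → ℝ → ℝ} (hψ : ∀ i, Measurable (ψ i))
    (hψ0 : ∀ i t, 0 ≤ ψ i t) (hφ : Measurable φ) (hφ0 : ∀ t, 0 ≤ φ t)
    (hlim : ∀ t, Tendsto (fun i => ψ i t) l (𝓝 (φ t))) (t : ℝ) :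
    Tendsto (fun i => convOp μ K g (ψ i) t) l (𝓝 (convOp μ K g φ t)) := by
  simp_rw [H.convOp_eq_integral_prod (hψ _) (hψ0 _), H.convOp_eq_integral_prod hφ hφ0]
  refine tendsto_integral_filter_of_dominated_convergence (fun p : ℝ × X => K p.1 p.2 * B)
    (Eventually.of_forall fun i => (H.measurable_integrand (hψ i) t).aestronglyMeasurable)
    (Eventually.of_forall fun i => Eventually.of_forall fun p => ?_)
    (H.integrable_kernel.mul_const B) (Eventually.of_forall fun p => ?_)
  · rw [Real.norm_of_nonneg (H.integrand_nonneg (hψ0 i) _ _ _)]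
    exact H.integrand_le (hψ0 i) _ _ _
  · refine Tendsto.const_mul _ ?_
    have h1 : Tendsto (fun i => ψ i (t - p.1)) l (𝓝[Ici 0] (φ (t - p.1))) :=
      tendsto_nhdsWithin_iff.2 ⟨hlim _, Eventually.of_forall fun i => hψ0 i _⟩
    exact (H.continuousOn_nonlin p.2 _ (hφ0 _)).tendsto.comp h1

theorem integrable_kernel_translate (H : IsConvData μ K g B) (h : ℝ) :
    Integrable (fun p : ℝ × X => K (h + p.1) p.2) ((volume : Measure ℝ).prod μ) := by
  have hm : Measurable fun p : ℝ × X => K (h + p.1) p.2 :=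
    H.measurable_kernel.comp ((measurable_const.add measurable_fst).prodMk measurable_snd)
  refine (integrable_prod_iff' hm.aestronglyMeasurable).2
    ⟨Eventually.of_forall fun τ => (H.integrable_slice τ).comp_add_left h, ?_⟩
  have h1 := ((integrable_prod_iff' H.integrable_kernel.aestronglyMeasurable).1
    H.integrable_kernel).2
  refine h1.congr (Eventually.of_forall fun τ => ?_)
  exact (integral_add_left_eq_self (fun s => ‖K s τ‖) h).symm

theorem tendsto_integral_kernel_translate_sub (H : IsConvData μ K g B) :
    Tendsto (fun h => ∫ τ, (∫ u, |K (h + u) τ - K u τ|) ∂μ) (𝓝 0) (𝓝 0) := by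
  suffices Tendsto (fun h => ∫ τ, (∫ u, |K (h + u) τ - K u τ|) ∂μ) (𝓝 0)
      (𝓝 (∫ _ : X, (0:ℝ) ∂μ)) by rwa [integral_zero] at this
  refine tendsto_integral_filter_of_dominated_convergence (fun τ => 2 * ∫ u, K u τ)
    (Eventually.of_forall fun h => ?_) (Eventually.of_forall fun h =>
      Eventually.of_forall fun τ => ?_) (H.integrable_kernel.integral_prod_right.const_mul 2)
    (Eventually.of_forall fun τ => (H.integrable_slice τ).tendsto_integral_abs_translate_sub)
  · exact (((H.integrable_kernel_translate h).sub
      H.integrable_kernel).abs.integral_prod_right).aestronglyMeasurable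
  · rw [Real.norm_of_nonneg (integral_nonneg fun _ => abs_nonneg _), two_mul]
    conv_rhs => rw [← integral_add_left_eq_self (fun u => K u τ) h]
    rw [integral_add_left_eq_self (fun u => K u τ) h]
    nth_rw 1 [← integral_add_left_eq_self (fun u => K u τ) h]
    rw [← integral_add ((H.integrable_slice τ).comp_add_left h) (H.integrable_slice τ)]
    refine integral_mono ((((H.integrable_slice τ).comp_add_left h).sub
      (H.integrable_slice τ)).abs) (((H.integrable_slice τ).comp_add_left h).add
      (H.integrable_slice τ)) fun u => ?_
    rw [abs_le]
    constructor <;> linarith [H.kernel_nonneg (h + u) τ, H.kernel_nonneg u τ]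

/-- The functions in the range of `convOp` share a modulus of continuity. -/
theorem exists_modulus (H : IsConvData μ K g B) :
    ∃ ω : ℝ → ℝ, Tendsto ω (𝓝 0) (𝓝 0) ∧ ∀ φ : ℝ → ℝ, Measurable φ → (∀ t, 0 ≤ φ t) →
      ∀ t t', |convOp μ K g φ t - convOp μ K g φ t'| ≤ ω (t - t') := by
  refine ⟨fun h => B * ∫ τ, (∫ u, |K (h + u) τ - K u τ|) ∂μ, ?_, ?_⟩
  · simpa using H.tendsto_integral_kernel_translate_sub.const_mul B
  intro φ hφ hφ0 t t'
  have hsl : ∀ t, Integrable (fun τ => ∫ s, K s τ * g (φ (t - s)) τ) μ := fun t =>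
    (H.integrable_integrand hφ hφ0 t).integral_prod_right
  have hd : Integrable (fun τ => ∫ u, |K (t - t' + u) τ - K u τ|) μ :=
    ((H.integrable_kernel_translate (t - t')).sub H.integrable_kernel).abs.integral_prod_right
  simp only [convOp]
  rw [← integral_sub (hsl t) (hsl t'), ← integral_const_mul]
  refine (abs_integral_le_integral_abs).trans (integral_mono ((hsl t).sub (hsl t')).abs
    (hd.const_mul B) fun τ => ?_)
  have hcv : ∫ s, K s τ * g (φ (t - s)) τ
      = ∫ u, K (t - t' + u) τ * g (φ (t' - u)) τ := by
    rw [← integral_add_left_eq_self _ (t - t')]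
    congr 1; ext u; congr 3; ring
  have hi1 : Integrable fun u => K (t - t' + u) τ * g (φ (t' - u)) τ := by
    have := (H.integrable_integrand_slice hφ hφ0 t τ).comp_add_left (t - t')
    refine this.congr (Eventually.of_forall fun u => ?_)
    simp only
    congr 3; ring
  have hi2 := H.integrable_integrand_slice hφ hφ0 t' τ
  simp only
  rw [hcv, ← integral_sub hi1 hi2, ← integral_const_mul]
  refine (abs_integral_le_integral_abs).trans (integral_mono (hi1.sub hi2).abs
    (((((H.integrable_slice τ).comp_add_left (t - t')).sub
      (H.integrable_slice τ)).abs).const_mul B) fun u => ?_)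
  simp only
  rw [← sub_mul, abs_mul, mul_comm B,
    abs_of_nonneg (H.nonlin_nonneg (φ (t' - u)) τ (hφ0 _))]
  exact mul_le_mul_of_nonneg_left (H.nonlin_le _ _ (hφ0 _)) (abs_nonneg _)

theorem continuous_convOp (H : IsConvData μ K g B) (hφ : Measurable φ) (hφ0 : ∀ t, 0 ≤ φ t) :
    Continuous (convOp μ K g φ) := by
  obtain ⟨ω, hω, hmod⟩ := H.exists_modulus
  rw [continuous_iff_continuousAt]
  intro t
  rw [ContinuousAt, tendsto_iff_dist_tendsto_zero]
  refine squeeze_zero (fun _ => dist_nonneg) (fun t' => hmod φ hφ hφ0 t' t) ?_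
  refine hω.comp ?_
  have : Tendsto (fun t' => t' - t) (𝓝 t) (𝓝 (t - t)) := (continuous_id.sub continuous_const).tendsto t
  rwa [sub_self] at this

/-- Pointwise asymptotic fixed points of `convOp` accumulate at a solution of the convolution
equation. -/
theorem exists_subseq_tendsto_solution (H : IsConvData μ K g B) {b : ℝ} {ψ : ℕ → ℝ → ℝ}
    (hψ : ∀ n, Measurable (ψ n)) (hψ0 : ∀ n t, 0 ≤ ψ n t)
    (hb : ∀ n t, convOp μ K g (ψ n) t ≤ b)
    (hlim : ∀ t, Tendsto (fun n => ψ n t - convOp μ K g (ψ n) t) atTop (𝓝 0)) :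
    ∃ (φ : ℝ → ℝ) (k : ℕ → ℕ), StrictMono k ∧ Continuous φ ∧
      (∀ t, Tendsto (fun n => ψ (k n) t) atTop (𝓝 (φ t))) ∧
      ∀ t, φ t = convOp μ K g φ t := by
  obtain ⟨ω, hω, hmod⟩ := H.exists_modulus
  obtain ⟨φ, k, hk, hφ⟩ := exists_subseq_tendsto_of_modulus
    (f := fun n => convOp μ K g (ψ n)) (a := 0) (b := b)
    (fun n t => ⟨H.convOp_nonneg (hψ0 n) t, hb n t⟩) hω fun n => hmod _ (hψ n) (hψ0 n)
  have hψk : ∀ t, Tendsto (fun n => ψ (k n) t) atTop (𝓝 (φ t)) := by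
    intro t
    have := ((hlim t).comp hk.tendsto_atTop).add (hφ t)
    simpa [Function.comp_def] using this
  have hφm : Measurable φ :=
    measurable_of_tendsto_metrizable (fun n => hψ (k n)) (tendsto_pi_nhds.2 hψk)
  have hφ0 : ∀ t, 0 ≤ φ t := fun t => ge_of_tendsto' (hψk t) fun n => hψ0 _ t
  have hsol : ∀ t, φ t = convOp μ K g φ t := fun t =>
    tendsto_nhds_unique (hφ t)
      (H.tendsto_convOp (fun n => hψ (k n)) (fun n => hψ0 _) hφm hφ0 hψk t)
  refine ⟨φ, k, hk, ?_, hψk, hsol⟩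
  rw [funext hsol]
  exact H.continuous_convOp hφm hφ0

end IsConvData

theorem abs_max_min_sub_le {l u c : ℝ} (hc : c ∈ Icc l u) (y : ℝ) :
    |max l (min y u) - c| ≤ |y - c| := by
  have h1 : max l (min c u) = c := by rw [min_eq_left hc.2, max_eq_right hc.1]
  conv_lhs => rw [← h1]
  exact (abs_max_sub_max_le_max _ _ _ _).trans
    (max_le (by simp) ((abs_min_sub_min_le_max _ _ _ _).trans (max_le le_rfl (by simp))))

theorem abs_floor_mul_div_sub_le (t : ℝ) {n : ℝ} (hn : 0 < n) : |⌊t * n⌋ / n - t| ≤ 1 / n := by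
  have h1 := Int.floor_le (t * n)
  have h2 := Int.lt_floor_add_one (t * n)
  have : ⌊t * n⌋ / n - t = (⌊t * n⌋ - t * n) / n := by field_simp
  rw [this, abs_div, abs_of_pos hn]
  gcongr
  rw [abs_le]
  constructor <;> linarith

namespace IsConvData

variable {X : Type*} [MeasurableSpace X] {μ : Measure X} [SFinite μ] {K g : ℝ → X → ℝ} {B : ℝ}

/-- Discretization: `convOp` has a fixed point up to evaluation on a grid of mesh `1 / n`. -/
theorem exists_grid_fixedPt (H : IsConvData μ K g B) {lo U : ℝ → ℝ} {b : ℝ} (hlo : Measurable lo)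
    (hU : Measurable U) (hlo0 : ∀ t, 0 ≤ lo t) (hloU : ∀ t, lo t ≤ U t) (hUb : ∀ t, U t ≤ b)
    (hinv : ∀ φ : ℝ → ℝ, Measurable φ → (∀ t, φ t ∈ Icc (lo t) (U t)) →
      ∀ t, convOp μ K g φ t ∈ Icc (lo t) (U t)) (n : ℕ) (hn : 0 < n) :
    ∃ φ : ℝ → ℝ, Measurable φ ∧ (∀ t, φ t ∈ Icc (lo t) (U t)) ∧ ∀ t : ℝ, |t| ≤ n →
      |φ t - convOp μ K g φ t| ≤ |convOp μ K g φ (⌊t * n⌋ / n) - convOp μ K g φ t| := by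
  have hN : -(n:ℤ) ^ 2 ≤ (n:ℤ) ^ 2 := by nlinarith [sq_nonneg (n:ℤ)]
  let ι := Icc (-(n:ℤ) ^ 2) ((n:ℤ) ^ 2)
  let idx : ℝ → ι := fun t => projIcc _ _ hN ⌊t * n⌋
  have hidx : Measurable idx :=
    (measurable_from_top (f := projIcc _ _ hN)).comp
      (Int.measurable_floor.comp (measurable_id.mul_const (n:ℝ)))
  let clamp : EuclideanSpace ℝ ι → ℝ → ℝ := fun x t => max (lo t) (min (x (idx t)) (U t))
  have hclamp : ∀ x t, clamp x t ∈ Icc (lo t) (U t) := fun x t =>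
    ⟨le_max_left _ _, max_le (hloU t) (min_le_right _ _)⟩
  have hclamp0 : ∀ x t, 0 ≤ clamp x t := fun x t => (hlo0 t).trans (hclamp x t).1
  have hclampm : ∀ x, Measurable (clamp x) := fun x =>
    hlo.max (((measurable_of_countable fun i : ι => x i).comp hidx).min hU)
  let F : EuclideanSpace ℝ ι → EuclideanSpace ℝ ι := fun x =>
    WithLp.toLp 2 fun i : ι => convOp μ K g (clamp x) ((i : ℤ) / n)
  have hF : Continuous F := by
    refine (PiLp.continuous_toLp 2 _).comp (continuous_pi fun i => ?_)
    rw [continuous_iff_continuousAt]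
    intro x
    refine H.tendsto_convOp hclampm hclamp0 (hclampm x) (hclamp0 x) (fun t => ?_) _
    have hc : Continuous fun y : EuclideanSpace ℝ ι => clamp y t := by
      simp only [clamp]; fun_prop
    exact hc.tendsto x
  have hFb : ∃ R, ∀ x, ‖F x‖ ≤ R := by
    have hK : IsCompact (WithLp.toLp 2 '' (univ.pi fun _ : ι => Icc 0 b) :
        Set (EuclideanSpace ℝ ι)) :=
      (isCompact_univ_pi fun _ => isCompact_Icc).image (PiLp.continuous_toLp 2 _)
    obtain ⟨R, hR⟩ := hK.isBounded.exists_norm_le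
    refine ⟨R, fun x => hR _ (mem_image_of_mem _ fun i _ => ?_)⟩
    have := hinv _ (hclampm x) (hclamp x) ((i : ℤ) / n)
    exact ⟨(hlo0 _).trans this.1, this.2.trans (hUb _)⟩
  obtain ⟨x, hx⟩ := hF.exists_fixedPt_of_bounded hFb
  refine ⟨clamp x, hclampm x, hclamp x, fun t ht => ?_⟩
  have hn' : (0:ℝ) < n := by exact_mod_cast hn
  have hmem : ⌊t * n⌋ ∈ Icc (-(n:ℤ) ^ 2) ((n:ℤ) ^ 2) := by
    rw [abs_le] at ht
    constructor
    · rw [Int.le_floor]; push_cast; nlinarith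
    · have : (⌊t * n⌋ : ℝ) ≤ (n:ℝ) ^ 2 := (Int.floor_le _).trans (by nlinarith)
      exact_mod_cast this
  have hi : ((idx t : ι) : ℤ) = ⌊t * n⌋ := by
    simp only [idx]; rw [projIcc_of_mem hN hmem]
  have hxi : x (idx t) = convOp μ K g (clamp x) (⌊t * n⌋ / n) := by
    conv_lhs => rw [← hx]
    simp only [F]
    rw [hi]
  rw [← hxi]
  exact abs_max_min_sub_le (hinv _ (hclampm x) (hclamp x) t) _

theorem exists_solution_mem_Icc (H : IsConvData μ K g B) {lo U : ℝ → ℝ} {b : ℝ}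
    (hlo : Measurable lo) (hU : Measurable U) (hlo0 : ∀ t, 0 ≤ lo t) (hloU : ∀ t, lo t ≤ U t)
    (hUb : ∀ t, U t ≤ b)
    (hinv : ∀ φ : ℝ → ℝ, Measurable φ → (∀ t, φ t ∈ Icc (lo t) (U t)) →
      ∀ t, convOp μ K g φ t ∈ Icc (lo t) (U t)) :
    ∃ φ : ℝ → ℝ, Continuous φ ∧ (∀ t, φ t ∈ Icc (lo t) (U t)) ∧ ∀ t, φ t = convOp μ K g φ t := by
  choose ψ hψm hψ hψgrid using fun n : ℕ =>
    H.exists_grid_fixedPt hlo hU hlo0 hloU hUb hinv (n + 1) n.succ_pos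
  have hψ0 : ∀ n t, 0 ≤ ψ n t := fun n t => (hlo0 t).trans (hψ n t).1
  obtain ⟨ω, hω, hmod⟩ := H.exists_modulus
  obtain ⟨φ, k, -, hφc, hlim, hsol⟩ := H.exists_subseq_tendsto_solution (b := b) hψm hψ0
    (fun n t => (hinv _ (hψm n) (hψ n) t).2.trans (hUb t)) (fun t => by
      have hgrid : Tendsto (fun n : ℕ => (⌊t * (n + 1 : ℕ)⌋ : ℝ) / (n + 1 : ℕ) - t) atTop (𝓝 0) := by
        refine squeeze_zero_norm (fun n => abs_floor_mul_div_sub_le t (by positivity)) ?_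
        simpa using tendsto_one_div_add_atTop_nhds_zero_nat (𝕜 := ℝ)
      refine squeeze_zero_norm' ?_ (hω.comp hgrid)
      obtain ⟨N, hN⟩ := exists_nat_ge |t|
      filter_upwards [eventually_ge_atTop N] with n hn
      have hn' : (N:ℝ) ≤ n := by exact_mod_cast hn
      exact (hψgrid n t (by push_cast; linarith)).trans (hmod _ (hψm n) (hψ0 n) _ _))
  exact ⟨φ, hφc, fun t => ⟨ge_of_tendsto' (hlim t) fun n => (hψ _ t).1,
    le_of_tendsto' (hlim t) fun n => (hψ _ t).2⟩, hsol⟩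

end IsConvData

/-! ### Interval dynamics -/

theorem lt_map_of_forall_ne {f : ℝ → ℝ} {a b : ℝ} (hab : a ≤ b) (hf : ContinuousOn f (Icc a b))
    (ha : a < f a) (hne : ∀ x ∈ Icc a b, f x ≠ x) : b < f b := by
  by_contra! h
  obtain ⟨x, hx, hx0⟩ := intermediate_value_Icc' hab (hf.sub continuousOn_id)
    (show (0:ℝ) ∈ Icc _ _ from ⟨sub_nonpos.2 h, (sub_pos.2 ha).le⟩)
  exact hne x hx (sub_eq_zero.1 hx0)

theorem map_lt_of_forall_ne {f : ℝ → ℝ} {a b : ℝ} (hab : a ≤ b) (hf : ContinuousOn f (Icc a b))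
    (hb : f b < b) (hne : ∀ x ∈ Icc a b, f x ≠ x) : f a < a := by
  by_contra! h
  obtain ⟨x, hx, hx0⟩ := intermediate_value_Icc' hab (hf.sub continuousOn_id)
    (show (0:ℝ) ∈ Icc _ _ from ⟨(sub_neg.2 hb).le, sub_nonneg.2 h⟩)
  exact hne x hx (sub_eq_zero.1 hx0)

/-- An interval covered by its image under a map of `(0, z]` with globally attracting fixed point
`κ`, and a repelling fixed point at `0`, reduces to `κ`. -/
theorem eq_of_le_map_of_attracting {G : ℝ → ℝ} {z κ d : ℝ} (hd : 0 < d)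
    (hG : ContinuousOn G (Icc 0 z)) (hmaps : ∀ x ∈ Icc 0 z, G x ∈ Icc 0 z)
    (hd1 : ∀ x, 0 < x → x ≤ d → x < G x) (hd2 : ∀ x, 0 < x → x ≤ d → x < G (G x))
    (hfix : ∀ s : ℝ, 0 ≤ s → (G s = s ↔ s = 0 ∨ s = κ))
    (hattr : ∀ s ∈ Ioc (0:ℝ) z, Tendsto (fun n => G^[n] s) atTop (𝓝 κ))
    {m M a b : ℝ} (hm : 0 < m) (hMz : M ≤ z) (ha : a ∈ Icc m M) (hb : b ∈ Icc m M)
    (hGa : G a ≤ m) (hGb : M ≤ G b) : m = κ ∧ M = κ := by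
  have hmM : m ≤ M := ha.1.trans ha.2
  have hz : 0 < z := hm.trans_le (hmM.trans hMz)
  have hiter : ∀ n, G^[n] z ∈ Icc 0 z := by
    intro n
    induction n with
    | zero => exact ⟨hz.le, le_rfl⟩
    | succ n ih => rw [Function.iterate_succ_apply']; exact hmaps _ ih
  have hκ0 : 0 ≤ κ := ge_of_tendsto' (hattr z ⟨hz, le_rfl⟩) fun n => (hiter n).1
  have hκz : κ ≤ z := le_of_tendsto' (hattr z ⟨hz, le_rfl⟩) fun n => (hiter n).2
  have hfixκ : G κ = κ := (hfix κ hκ0).2 (Or.inr rfl)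
  have hbelow : ∀ x, 0 < x → x ≤ z → (x < κ ∨ κ = 0) → x < G x := by
    intro x hx hxz hxκ
    rcases le_total x d with h | h
    · exact hd1 x hx h
    refine lt_map_of_forall_ne h (hG.mono (Icc_subset_Icc hd.le hxz)) (hd1 d hd le_rfl) ?_
    intro y hy hy0
    rcases (hfix y (hd.le.trans hy.1)).1 hy0 with h0 | h0
    · linarith [hy.1]
    · rcases hxκ with h1 | h1 <;> linarith [hy.1, hy.2]
  have hκpos : 0 < κ := by
    refine hκ0.lt_of_ne fun h => ?_
    exact (hbelow z hz le_rfl (Or.inr h.symm)).not_ge (hmaps z ⟨hz.le, le_rfl⟩).2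
  have habove : ∀ x, κ < x → x ≤ z → G x < x := by
    intro x hx hxz
    have hne : ∀ y ∈ Icc x z, G y ≠ y := by
      intro y hy hy0
      rcases (hfix y (by linarith [hy.1])).1 hy0 with h0 | h0 <;> linarith [hy.1]
    exact map_lt_of_forall_ne hxz (hG.mono (Icc_subset_Icc (by linarith) le_rfl))
      ((hmaps z ⟨hz.le, le_rfl⟩).2.lt_of_ne (hne z ⟨hxz, le_rfl⟩)) hne
  have htwo : ∀ x, 0 < x → x < κ → x < G (G x) := by
    intro x hx hxκ
    rcases le_total x d with h | h
    · exact hd2 x hx h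
    have hG2 : ContinuousOn (fun y => G (G y)) (Icc 0 z) := hG.comp hG hmaps
    refine lt_map_of_forall_ne (f := fun y => G (G y)) h
      (hG2.mono (Icc_subset_Icc hd.le (by linarith))) (hd2 d hd le_rfl) ?_
    intro y hy hy0
    have hper : ∀ n, G^[2 * n] y = y := by
      intro n
      rw [Function.iterate_mul]
      exact Function.iterate_fixed hy0 n
    have hsub : Tendsto (fun n => G^[2 * n] y) atTop (𝓝 κ) :=
      (hattr y ⟨hd.trans_le hy.1, by linarith [hy.2]⟩).comp
        (tendsto_id.const_mul_atTop' two_pos)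
    simp only [hper] at hsub
    have := tendsto_nhds_unique hsub tendsto_const_nhds
    linarith [hy.2]
  have haκ : m < κ → κ < a := by
    intro h
    by_contra! hle
    rcases hle.lt_or_eq with h1 | h1
    · linarith [hbelow a (by linarith [ha.1]) (by linarith) (Or.inl h1), ha.1]
    · rw [h1, hfixκ] at hGa; linarith
  have hbκ : κ < M → b < κ := by
    intro h
    by_contra! hle
    rcases hle.lt_or_eq with h1 | h1
    · linarith [habove b h1 (by linarith [hb.2]), hb.2]
    · rw [← h1, hfixκ] at hGb; linarith
  have hM : M ≤ κ := by
    by_contra! h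
    have hb1 := hbκ h
    have ha1 := haκ (hb.1.trans_lt hb1)
    obtain ⟨c, hc, hca⟩ := intermediate_value_Icc' hb1.le
      (hG.mono (Icc_subset_Icc (by linarith [hb.1]) hκz))
      (show a ∈ Icc _ _ from ⟨by rw [hfixκ]; exact ha1.le, ha.2.trans hGb⟩)
    have hcκ : c < κ := by
      refine hc.2.lt_of_ne fun h => ?_
      rw [h, hfixκ] at hca
      linarith
    have := htwo c (by linarith [hb.1, hc.1]) hcκ
    rw [hca] at this
    linarith [hb.1, hc.1]
  have hm' : κ ≤ m := by
    by_contra! h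
    linarith [haκ h, ha.2]
  exact ⟨le_antisymm (hmM.trans hM) hm', le_antisymm hM (hm'.trans hmM)⟩

/-! ### Asymptotic oscillation -/

theorem exists_seq_tendsto_of_frequently {φ : ℝ → ℝ} {c : ℝ}
    (h : ∀ ε > 0, ∃ᶠ t in atTop, |φ t - c| < ε) :
    ∃ u : ℕ → ℝ, Tendsto u atTop atTop ∧ Tendsto (fun n => φ (u n)) atTop (𝓝 c) := by
  have h1 : ∀ n : ℕ, ∃ t : ℝ, (n:ℝ) ≤ t ∧ |φ t - c| < 1 / ((n:ℝ) + 1) := fun n =>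
    frequently_atTop.1 (h _ (by positivity)) n
  choose u hu hφ using h1
  refine ⟨u, tendsto_atTop_mono hu tendsto_natCast_atTop_atTop, ?_⟩
  rw [tendsto_iff_dist_tendsto_zero]
  exact squeeze_zero (fun _ => dist_nonneg) (fun n => (hφ n).le)
    tendsto_one_div_add_atTop_nhds_zero_nat

theorem exists_oscillation_bounds {φ : ℝ → ℝ} {a b : ℝ} (h : ∀ᶠ t in atTop, φ t ∈ Icc a b) :
    ∃ m M, a ≤ m ∧ M ≤ b ∧ (∀ c < m, ∀ᶠ t in atTop, c < φ t) ∧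
      (∀ c > M, ∀ᶠ t in atTop, φ t < c) ∧
      (∃ u : ℕ → ℝ, Tendsto u atTop atTop ∧ Tendsto (fun n => φ (u n)) atTop (𝓝 m)) ∧
      ∃ u : ℕ → ℝ, Tendsto u atTop atTop ∧ Tendsto (fun n => φ (u n)) atTop (𝓝 M) := by
  have hle : IsBoundedUnder (· ≤ ·) atTop φ := isBoundedUnder_of_eventually_le (h.mono fun _ h => h.2)
  have hge : IsBoundedUnder (· ≥ ·) atTop φ := isBoundedUnder_of_eventually_ge (h.mono fun _ h => h.1)
  have h1 : ∀ c < liminf φ atTop, ∀ᶠ t in atTop, c < φ t := fun c hc =>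
    eventually_lt_of_lt_liminf hc hge
  have h2 : ∀ c > limsup φ atTop, ∀ᶠ t in atTop, φ t < c := fun c hc =>
    eventually_lt_of_limsup_lt hc hle
  refine ⟨liminf φ atTop, limsup φ atTop, le_liminf_of_le hle.isCoboundedUnder_ge
    (h.mono fun _ h => h.1), limsup_le_of_le hge.isCoboundedUnder_le (h.mono fun _ h => h.2),
    h1, h2, exists_seq_tendsto_of_frequently fun ε hε => ?_,
    exists_seq_tendsto_of_frequently fun ε hε => ?_⟩
  · refine ((frequently_lt_of_liminf_lt hle.isCoboundedUnder_ge
      (lt_add_of_pos_right _ hε)).and_eventually (h1 _ (sub_lt_self _ hε))).mono fun t ht => ?_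
    rw [abs_lt]; constructor <;> linarith [ht.1, ht.2]
  · refine ((frequently_lt_of_lt_limsup hge.isCoboundedUnder_le
      (sub_lt_self _ hε)).and_eventually (h2 _ (lt_add_of_pos_right _ hε))).mono fun t ht => ?_
    rw [abs_lt]; constructor <;> linarith [ht.1, ht.2]

theorem convOp_comp_const_add {X : Type*} [MeasurableSpace X] (μ : Measure X) (K g : ℝ → X → ℝ)
    (φ : ℝ → ℝ) (c t : ℝ) : convOp μ K g (fun s => φ (c + s)) t = convOp μ K g φ (c + t) := by
  simp only [convOp, add_sub_assoc]

namespace IsConvData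

variable {X : Type*} [MeasurableSpace X] {μ : Measure X} [SFinite μ] {K g : ℝ → X → ℝ} {B : ℝ}

/-- Limits of translates of a solution are solutions. -/
theorem exists_limit_solution (H : IsConvData μ K g B) {φ : ℝ → ℝ} (hφ : Measurable φ)
    (hφ0 : ∀ t, 0 ≤ φ t) {b : ℝ} (hb : ∀ t, φ t ≤ b) (hsol : ∀ t, φ t = convOp μ K g φ t)
    {m M c : ℝ} (hm : ∀ c < m, ∀ᶠ t in atTop, c < φ t) (hM : ∀ c > M, ∀ᶠ t in atTop, φ t < c)
    {u : ℕ → ℝ} (hu : Tendsto u atTop atTop) (huc : Tendsto (fun n => φ (u n)) atTop (𝓝 c)) :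
    ∃ ψ : ℝ → ℝ, Measurable ψ ∧ (∀ t, ψ t ∈ Icc m M) ∧ convOp μ K g ψ 0 = c := by
  obtain ⟨ψ, k, hk, hψc, hlim, hψ⟩ := H.exists_subseq_tendsto_solution (b := b)
    (ψ := fun n s => φ (u n + s)) (fun n => hφ.comp (measurable_const.add measurable_id))
    (fun n t => hφ0 _) (fun n t => by rw [convOp_comp_const_add, ← hsol]; exact hb _)
    (fun t => by simp [convOp_comp_const_add, ← hsol])
  have htr : ∀ t, Tendsto (fun n => u (k n) + t) atTop atTop := fun t =>
    tendsto_atTop_add_const_right _ t (hu.comp hk.tendsto_atTop)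
  refine ⟨ψ, hψc.measurable, fun t => ⟨?_, ?_⟩, ?_⟩
  · refine le_of_forall_lt_imp_le_of_dense fun c hc => ?_
    exact ge_of_tendsto (hlim t) (((htr t).eventually (hm c hc)).mono fun _ h => h.le)
  · refine le_of_forall_gt_imp_ge_of_dense fun c hc => ?_
    exact le_of_tendsto (hlim t) (((htr t).eventually (hM c hc)).mono fun _ h => h.le)
  · rw [← hψ 0]
    refine tendsto_nhds_unique (hlim 0) ?_
    simpa [Function.comp_def] using huc.comp hk.tendsto_atTop

end IsConvData

/-! ### Splitting off an atom -/

theorem measure_restrict_compl_singleton_of_not_measurableSet {X : Type*} [MeasurableSpace X]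
    (μ : Measure X) [IsFiniteMeasure μ] {a : X} (ha : ¬ MeasurableSet ({a} : Set X)) :
    μ.restrict {a}ᶜ = μ := by
  have hsub : (toMeasurable μ {a}ᶜ)ᶜ ⊆ {a} := by
    rw [compl_subset_comm]; exact subset_toMeasurable _ _
  rw [← Measure.restrict_toMeasurable (measure_ne_top μ _)]
  rcases subset_singleton_iff_eq.1 hsub with h | h
  · rw [compl_empty_iff.1 h, Measure.restrict_univ]
  · exact absurd (h ▸ (measurableSet_toMeasurable _ _).compl) ha

theorem integral_eq_setIntegral_compl_add_of_measure_singleton {X : Type*} [MeasurableSpace X]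
    {μ : Measure X} {a : X} (ha : MeasurableSet ({a} : Set X)) (ha1 : μ {a} = 1) {F : X → ℝ}
    (hF : Integrable F μ) : ∫ τ, F τ ∂μ = (∫ τ in {a}ᶜ, F τ ∂μ) + F a := by
  rw [← integral_add_compl ha hF, add_comm]
  congr 1
  rw [setIntegral_congr_fun (g := fun _ => F a) ha fun x hx => by rw [mem_singleton_iff.1 hx],
    setIntegral_const, measureReal_def, ha1]
  simp

namespace IsConvData

variable {X : Type*} [MeasurableSpace X] {μ : Measure X} [SFinite μ] {K g : ℝ → X → ℝ} {B : ℝ}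

theorem integrable_nonlin_mul_kernel (H : IsConvData μ K g B) {v : ℝ} (hv : 0 ≤ v) :
    Integrable (fun τ => g v τ * ∫ s, K s τ) μ := by
  refine ((H.integrable_integrand (φ := fun _ => v) measurable_const (fun _ => hv)
    0).integral_prod_right).congr (Eventually.of_forall fun τ => ?_)
  simp only
  rw [integral_mul_const, mul_comm]

variable {τ0 : X}

theorem convOp_eq_add (H : IsConvData μ K g B) (hτ : MeasurableSet ({τ0} : Set X))
    (hτ1 : μ {τ0} = 1) {φ : ℝ → ℝ} (hφ : Measurable φ) (hφ0 : ∀ t, 0 ≤ φ t) (t : ℝ) :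
    convOp μ K g φ t = (∫ τ in {τ0}ᶜ, (∫ s, K s τ * g (φ (t - s)) τ) ∂μ)
      + ∫ s, K s τ0 * g (φ (t - s)) τ0 :=
  integral_eq_setIntegral_compl_add_of_measure_singleton hτ hτ1
    (H.integrable_integrand hφ hφ0 t).integral_prod_right

theorem convOp_le_add (H : IsConvData μ K g B) (hτ : MeasurableSet ({τ0} : Set X))
    (hτ1 : μ {τ0} = 1) (hmono : ∀ τ, τ ≠ τ0 → MonotoneOn (fun v => g v τ) (Ici 0))
    {φ : ℝ → ℝ} (hφ : Measurable φ) {M c : ℝ} (hφM : ∀ t, φ t ∈ Icc 0 M)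
    (hc : ∀ t, g (φ t) τ0 ≤ c) (t : ℝ) :
    convOp μ K g φ t ≤ (∫ τ in {τ0}ᶜ, (g M τ * ∫ s, K s τ) ∂μ) + (∫ s, K s τ0) * c := by
  have hφ0 : ∀ t, 0 ≤ φ t := fun t => (hφM t).1
  have hM : 0 ≤ M := (hφM 0).1.trans (hφM 0).2
  rw [H.convOp_eq_add hτ hτ1 hφ hφ0]
  refine add_le_add ?_ ?_
  · refine setIntegral_mono_on (H.integrable_integrand hφ hφ0 t).integral_prod_right.integrableOn
      (H.integrable_nonlin_mul_kernel hM).integrableOn hτ.compl fun τ hne => ?_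
    rw [mul_comm, ← integral_mul_const]
    exact integral_mono (H.integrable_integrand_slice hφ hφ0 t τ)
      ((H.integrable_slice τ).mul_const _) fun s => mul_le_mul_of_nonneg_left
        (hmono τ hne (hφ0 _) hM (hφM _).2) (H.kernel_nonneg _ _)
  · rw [← integral_mul_const]
    exact integral_mono (H.integrable_integrand_slice hφ hφ0 t τ0)
      ((H.integrable_slice τ0).mul_const _) fun s =>
        mul_le_mul_of_nonneg_left (hc _) (H.kernel_nonneg _ _)

theorem add_le_convOp (H : IsConvData μ K g B) (hτ : MeasurableSet ({τ0} : Set X))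
    (hτ1 : μ {τ0} = 1) (hmono : ∀ τ, τ ≠ τ0 → MonotoneOn (fun v => g v τ) (Ici 0))
    {φ : ℝ → ℝ} (hφ : Measurable φ) {m c : ℝ} (hm : 0 ≤ m) (hφm : ∀ t, m ≤ φ t)
    (hc : ∀ t, c ≤ g (φ t) τ0) (t : ℝ) :
    (∫ τ in {τ0}ᶜ, (g m τ * ∫ s, K s τ) ∂μ) + (∫ s, K s τ0) * c ≤ convOp μ K g φ t := by
  have hφ0 : ∀ t, 0 ≤ φ t := fun t => hm.trans (hφm t)
  rw [H.convOp_eq_add hτ hτ1 hφ hφ0]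
  refine add_le_add ?_ ?_
  · refine setIntegral_mono_on (H.integrable_nonlin_mul_kernel hm).integrableOn
      (H.integrable_integrand hφ hφ0 t).integral_prod_right.integrableOn hτ.compl fun τ hne => ?_
    rw [mul_comm, ← integral_mul_const]
    exact integral_mono ((H.integrable_slice τ).mul_const _)
      (H.integrable_integrand_slice hφ hφ0 t τ) fun s => mul_le_mul_of_nonneg_left
        (hmono τ hne hm (hφ0 _) (hφm _)) (H.kernel_nonneg _ _)
  · rw [← integral_mul_const]
    exact integral_mono ((H.integrable_slice τ0).mul_const _)
      (H.integrable_integrand_slice hφ hφ0 t τ0) fun s =>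
        mul_le_mul_of_nonneg_left (hc _) (H.kernel_nonneg _ _)

/-! ### Comparison with exponentials -/

variable {g' : X → ℝ} {lam z r δ : ℝ} {φ : ℝ → ℝ}

theorem convOp_le_exp (H : IsConvData μ K g B)
    (hlamint : Integrable (fun p : ℝ × X => K p.1 p.2 * g' p.2 * Real.exp (-(p.1 * lam)))
      ((volume : Measure ℝ).prod μ))
    (hlam : (∫ τ, (∫ s, K s τ * g' τ * Real.exp (-(s * lam))) ∂μ) = 1)
    (hφ : Measurable φ) (hφ0 : ∀ t, 0 ≤ φ t) {t : ℝ}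
    (hle : ∀ s τ, g (φ (t - s)) τ ≤ g' τ * (δ * Real.exp (lam * (t - s)))) :
    convOp μ K g φ t ≤ δ * Real.exp (lam * t) := by
  have hI : ∫ p : ℝ × X, K p.1 p.2 * g' p.2 * Real.exp (-(p.1 * lam)) ∂(volume : Measure ℝ).prod μ
      = 1 := by rw [integral_prod_symm _ hlamint, hlam]
  rw [H.convOp_eq_integral_prod hφ hφ0, ← mul_one (δ * Real.exp (lam * t)), ← hI,
    ← integral_const_mul]
  refine integral_mono (H.integrable_integrand hφ hφ0 t) (hlamint.const_mul _) fun p => ?_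
  refine (mul_le_mul_of_nonneg_left (hle p.1 p.2) (H.kernel_nonneg _ _)).trans_eq ?_
  rw [show lam * (t - p.1) = lam * t + -(p.1 * lam) by ring, Real.exp_add]
  ring

theorem exp_sub_le_convOp (H : IsConvData μ K g B)
    (hlamint : Integrable (fun p : ℝ × X => K p.1 p.2 * g' p.2 * Real.exp (-(p.1 * lam)))
      ((volume : Measure ℝ).prod μ))
    (hlam : (∫ τ, (∫ s, K s τ * g' τ * Real.exp (-(s * lam))) ∂μ) = 1)
    (hzint : Integrable (fun p : ℝ × X => K p.1 p.2 * g' p.2 * Real.exp (-(p.1 * z)))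
      ((volume : Measure ℝ).prod μ))
    (hz : (∫ τ, (∫ s, K s τ * g' τ * Real.exp (-(s * z))) ∂μ) ≤ 1)
    (hφ : Measurable φ) (hφ0 : ∀ t, 0 ≤ φ t) (hδ : 0 ≤ δ) (hr : 0 ≤ r) {t t' : ℝ}
    (hle : ∀ s τ, g' τ * (δ * (Real.exp (lam * (t' - s)) - r * Real.exp (z * (t' - s))))
      ≤ g (φ (t - s)) τ) :
    δ * (Real.exp (lam * t') - r * Real.exp (z * t')) ≤ convOp μ K g φ t := by
  have hI : ∫ p : ℝ × X, K p.1 p.2 * g' p.2 * Real.exp (-(p.1 * lam)) ∂(volume : Measure ℝ).prod μ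
      = 1 := by rw [integral_prod_symm _ hlamint, hlam]
  have hJ : ∫ p : ℝ × X, K p.1 p.2 * g' p.2 * Real.exp (-(p.1 * z)) ∂(volume : Measure ℝ).prod μ
      ≤ 1 := by rwa [integral_prod_symm _ hzint]
  have h1 : δ * (Real.exp (lam * t') - r * Real.exp (z * t'))
      ≤ δ * Real.exp (lam * t') * (∫ p : ℝ × X, K p.1 p.2 * g' p.2 * Real.exp (-(p.1 * lam))
        ∂(volume : Measure ℝ).prod μ) - δ * r * Real.exp (z * t') *
          ∫ p : ℝ × X, K p.1 p.2 * g' p.2 * Real.exp (-(p.1 * z)) ∂(volume : Measure ℝ).prod μ := by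
    rw [hI]
    have : 0 ≤ δ * r * Real.exp (z * t') := by positivity
    nlinarith
  refine h1.trans ?_
  rw [H.convOp_eq_integral_prod hφ hφ0, ← integral_const_mul, ← integral_const_mul,
    ← integral_sub (hlamint.const_mul _) (hzint.const_mul _)]
  refine integral_mono ((hlamint.const_mul _).sub (hzint.const_mul _))
    (H.integrable_integrand hφ hφ0 t) fun p => ?_
  refine le_trans (le_of_eq ?_) (mul_le_mul_of_nonneg_left (hle p.1 p.2) (H.kernel_nonneg _ _))
  rw [show lam * (t' - p.1) = lam * t' + -(p.1 * lam) by ring,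
    show z * (t' - p.1) = z * t' + -(p.1 * z) by ring, Real.exp_add, Real.exp_add]
  ring

end IsConvData

/-! ### Solutions between exponential barriers -/

theorem StrictMonoOn.continuousOn_of_comp_eq {Θ G f : ℝ → ℝ} {a b : ℝ} {s : Set ℝ}
    (hΘ : StrictMonoOn Θ (Icc a b)) (hf : ContinuousOn f s) (hG : ∀ v ∈ s, G v ∈ Icc a b)
    (hGf : ∀ v ∈ s, Θ (G v) = f v) : ContinuousOn G s := by
  intro v hv
  refine tendsto_order.2 ⟨fun c hc => ?_, fun c hc => ?_⟩
  · rcases lt_or_ge c a with h | h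
    · filter_upwards [self_mem_nhdsWithin] with w hw using h.trans_le (hG w hw).1
    · have hc' : c ∈ Icc a b := ⟨h, hc.le.trans (hG v hv).2⟩
      have h1 : Θ c < f v := by rw [← hGf v hv]; exact hΘ hc' (hG v hv) hc
      filter_upwards [self_mem_nhdsWithin, (hf v hv).eventually_const_lt h1] with w hw h2
      rw [← hGf w hw] at h2
      exact (hΘ.lt_iff_lt hc' (hG w hw)).1 h2
  · rcases lt_or_ge b c with h | h
    · filter_upwards [self_mem_nhdsWithin] with w hw using (hG w hw).2.trans_lt h
    · have hc' : c ∈ Icc a b := ⟨(hG v hv).1.trans hc.le, h⟩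
      have h1 : f v < Θ c := by rw [← hGf v hv]; exact hΘ (hG v hv) hc' hc
      filter_upwards [self_mem_nhdsWithin, (hf v hv).eventually_lt_const h1] with w hw h2
      rw [← hGf w hw] at h2
      exact (hΘ.lt_iff_lt (hG w hw) hc').1 h2

namespace IsConvData

variable {X : Type*} [MeasurableSpace X] {μ : Measure X} [IsFiniteMeasure μ] {K g : ℝ → X → ℝ}
  {B : ℝ}

/-- A solution between `δ (e^{lam t} - e^{(lam + ε) t})` and `min (δ e^{lam t}) ζ` that stays bounded
away from `0` at `+∞`. -/
theorem exists_solution_of_exp_barriers (H : IsConvData μ K g B) {g' : X → ℝ}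
    (hg' : ∀ τ, 0 < g' τ) {δ lam ε ζ δ' : ℝ} (hδ : 0 < δ) (hlam : 0 < lam) (hε : 0 < ε)
    (hδζ : δ < ζ) (hδ'0 : 0 < δ') (hδ'δ : δ' ≤ δ)
    (hlin : ∀ τ, ∀ s ∈ Icc (0:ℝ) δ, g s τ = g' τ * s)
    (hsub : ∀ τ, ∀ s, 0 ≤ s → g s τ ≤ g' τ * s)
    (hlow : ∀ τ, ∀ v ≤ δ', ∀ w ∈ Icc 0 ζ, v ≤ w → g' τ * v ≤ g w τ)
    (hmax : ∀ φ, Measurable φ → (∀ t, φ t ∈ Icc 0 ζ) → ∀ t, convOp μ K g φ t ≤ ζ)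
    (hlamint : Integrable (fun p : ℝ × X => K p.1 p.2 * g' p.2 * Real.exp (-(p.1 * lam)))
      ((volume : Measure ℝ).prod μ))
    (hlamone : (∫ τ, (∫ s, K s τ * g' τ * Real.exp (-(s * lam))) ∂μ) = 1)
    (hνint : Integrable (fun p : ℝ × X => K p.1 p.2 * g' p.2 * Real.exp (-(p.1 * (lam + ε))))
      ((volume : Measure ℝ).prod μ))
    (hν : (∫ τ, (∫ s, K s τ * g' τ * Real.exp (-(s * (lam + ε)))) ∂μ) ≤ 1) :
    ∃ φ : ℝ → ℝ, Continuous φ ∧ (∀ t, φ t ∈ Icc 0 ζ) ∧ (∀ t, φ t = convOp μ K g φ t) ∧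
      (∀ t, φ t ≤ δ * Real.exp (lam * t)) ∧
      (∀ t, δ * (Real.exp (lam * t) - 1 * Real.exp ((lam + ε) * t)) ≤ φ t) ∧
      ∃ m > 0, ∀ᶠ t in atTop, m ≤ φ t := by
  set L : ℝ → ℝ → ℝ := fun M t => δ * (Real.exp (lam * t) - M * Real.exp ((lam + ε) * t)) with hL
  have hLle : ∀ M, 0 ≤ M → ∀ t, L M t ≤ δ * Real.exp (lam * t) := fun M hM t =>
    mul_le_mul_of_nonneg_left (sub_le_self _ (by positivity)) hδ.le
  have hfac : ∀ a t, L (Real.exp (-(ε * a))) t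
      = δ * Real.exp (lam * t) * (1 - Real.exp (ε * (t - a))) := fun a t => by
    have : Real.exp (-(ε * a)) * Real.exp ((lam + ε) * t)
        = Real.exp (lam * t) * Real.exp (ε * (t - a)) := by
      rw [← Real.exp_add, ← Real.exp_add]; ring_nf
    simp only [hL, this]; ring
  have hneg : ∀ a t, a ≤ t → L (Real.exp (-(ε * a))) t ≤ 0 := fun a t hat => by
    rw [hfac]
    exact mul_nonpos_of_nonneg_of_nonpos (by positivity)
      (sub_nonpos.2 (Real.one_le_exp (mul_nonneg hε.le (sub_nonneg.2 hat))))
  have hneg1 : ∀ t, 0 ≤ t → L 1 t ≤ 0 := fun t ht => by simpa using hneg 0 t ht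
  set a := Real.log (δ' / δ) / lam with ha
  have hexpa : δ * Real.exp (lam * a) = δ' := by
    rw [ha, mul_div_cancel₀ _ hlam.ne', Real.exp_log (by positivity), mul_div_cancel₀ _ hδ.ne']
  set N := Real.exp (-(ε * a)) with hN
  have hN0 : 0 ≤ N := (Real.exp_pos _).le
  have hLN : ∀ t, L N t ≤ δ' := fun t => by
    rcases le_total a t with h | h
    · exact (hneg a t h).trans hδ'0.le
    · refine (hLle N hN0 t).trans ?_
      rw [← hexpa]; gcongr
  have hm : 0 < L N (a - 1) := by
    rw [hN, hfac]
    refine mul_pos (by positivity) (sub_pos.2 (Real.exp_lt_one_iff.2 ?_))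
    nlinarith
  set L2 : ℝ → ℝ := fun t => sSup (L N '' Iic t) with hL2
  have hbdd : ∀ t, BddAbove (L N '' Iic t) := fun t =>
    ⟨δ', by rintro _ ⟨s, -, rfl⟩; exact hLN s⟩
  have hne : ∀ t, (L N '' Iic t).Nonempty := fun t => nonempty_Iic.image _
  have hL2le : ∀ {t' t}, t' ≤ t → L N t' ≤ L2 t := fun h => le_csSup (hbdd _) ⟨_, h, rfl⟩
  have hL2mono : Monotone L2 := fun t1 t2 h =>
    csSup_le_csSup (hbdd _) (hne _) (image_mono (Iic_subset_Iic.2 h))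
  set U : ℝ → ℝ := fun t => min (δ * Real.exp (lam * t)) ζ with hU
  set lo : ℝ → ℝ := fun t => max 0 (max (L 1 t) (L2 t)) with hlo
  have hUδ : ∀ t ≤ 0, δ * Real.exp (lam * t) ≤ δ := fun t ht =>
    mul_le_of_le_one_right hδ.le (Real.exp_le_one_iff.2 (mul_nonpos_of_nonneg_of_nonpos hlam.le ht))
  have hL1ζ : ∀ t, L 1 t ≤ ζ := fun t => by
    rcases le_total 0 t with h | h
    · exact (hneg1 t h).trans (hδ.trans hδζ).le
    · exact ((hLle 1 zero_le_one t).trans (hUδ t h)).trans hδζ.le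
  have hζ0 : 0 ≤ ζ := (hδ.trans hδζ).le
  have key := H.exists_solution_mem_Icc (lo := lo) (U := U) (b := ζ)
    (by
      have : Measurable (L 1) := by fun_prop
      exact measurable_const.max (this.max hL2mono.measurable))
    (by fun_prop) (fun t => le_max_left _ _)
    (fun t => le_min
      (max_le (by positivity) (max_le (hLle 1 zero_le_one t) (csSup_le (hne t) (by
        rintro _ ⟨s, hs, rfl⟩
        exact (hLle N hN0 s).trans (by gcongr; exact hs)))))
      (max_le hζ0 (max_le (hL1ζ t) (csSup_le (hne t) (by
        rintro _ ⟨s, hs, rfl⟩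
        exact (hLN s).trans (hδ'δ.trans hδζ.le))))))
    (fun t => min_le_right _ _)
    (fun φ hφ hφI t => by
      have h0 : ∀ t, 0 ≤ φ t := fun t => (le_max_left _ _).trans (hφI t).1
      have hexp : ∀ t, φ t ≤ δ * Real.exp (lam * t) := fun t => (hφI t).2.trans (min_le_left _ _)
      have hζ : ∀ t, φ t ∈ Icc 0 ζ := fun t => ⟨h0 t, (hφI t).2.trans (min_le_right _ _)⟩
      have h1 : ∀ t, L 1 t ≤ φ t := fun t =>
        ((le_max_left _ _).trans (le_max_right _ _)).trans (hφI t).1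
      have h2 : ∀ t, L2 t ≤ φ t := fun t =>
        ((le_max_right _ _).trans (le_max_right _ _)).trans (hφI t).1
      refine ⟨max_le (H.convOp_nonneg h0 t) (max_le ?_ (csSup_le (hne t) ?_)),
        le_min (H.convOp_le_exp hlamint hlamone hφ h0 fun s τ => (hsub τ _ (h0 _)).trans
          (mul_le_mul_of_nonneg_left (hexp _) (hg' τ).le)) (hmax φ hφ hζ t)⟩
      · refine H.exp_sub_le_convOp hlamint hlamone hνint hν hφ h0 hδ.le zero_le_one fun s τ => ?_
        rcases le_total 0 (t - s) with h | h
        · exact (mul_nonpos_of_nonneg_of_nonpos (hg' τ).le (hneg1 _ h)).trans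
            (H.nonlin_nonneg _ _ (h0 _))
        · rw [hlin τ _ ⟨h0 _, (hexp _).trans (hUδ _ h)⟩]
          exact mul_le_mul_of_nonneg_left (h1 _) (hg' τ).le
      · rintro _ ⟨t', ht', rfl⟩
        refine H.exp_sub_le_convOp hlamint hlamone hνint hν hφ h0 hδ.le hN0 fun s τ => ?_
        exact hlow τ _ (hLN _) _ (hζ _) ((hL2le (sub_le_sub_right ht' s)).trans (h2 _)))
  obtain ⟨φ, hφc, hφI, hsol⟩ := key
  refine ⟨φ, hφc, fun t => ⟨(le_max_left _ _).trans (hφI t).1, (hφI t).2.trans (min_le_right _ _)⟩,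
    hsol, fun t => (hφI t).2.trans (min_le_left _ _),
    fun t => ((le_max_left _ _).trans (le_max_right _ _)).trans (hφI t).1,
    L N (a - 1), hm, (eventually_ge_atTop (a - 1)).mono fun t ht => ?_⟩
  exact (hL2le ht).trans (((le_max_right _ _).trans (le_max_right _ _)).trans (hφI t).1)

/-- A persistent solution converges to the globally attracting fixed point of the associated
interval map. -/
theorem tendsto_atTop_of_attracting (H : IsConvData μ K g B) {τ0 : X}
    (hτ : MeasurableSet ({τ0} : Set X)) (hτ1 : μ {τ0} = 1)
    (hmono : ∀ τ, τ ≠ τ0 → MonotoneOn (fun v => g v τ) (Ici 0)) {ζ : ℝ}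
    (hΘ : StrictMonoOn (fun v => v - ∫ τ in {τ0}ᶜ, (g v τ * ∫ s, K s τ) ∂μ) (Icc 0 ζ)) {G : ℝ → ℝ}
    (hG : ∀ v, 0 ≤ v → G v ∈ Icc 0 ζ ∧
      G v - (∫ τ in {τ0}ᶜ, (g (G v) τ * ∫ s, K s τ) ∂μ) = (∫ s, K s τ0) * g v τ0)
    {d κ : ℝ} (hd : 0 < d) (hd1 : ∀ x, 0 < x → x ≤ d → x < G x)
    (hd2 : ∀ x, 0 < x → x ≤ d → x < G (G x))
    (hfix : ∀ s, 0 ≤ s → (G s = s ↔ s = 0 ∨ s = κ))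
    (hattr : ∀ s ∈ Ioc 0 ζ, Tendsto (fun n => G^[n] s) atTop (𝓝 κ))
    {φ : ℝ → ℝ} (hφ : Measurable φ) (hφζ : ∀ t, φ t ∈ Icc 0 ζ)
    (hsol : ∀ t, φ t = convOp μ K g φ t) {m₀ : ℝ} (hm₀ : 0 < m₀) (hφm : ∀ᶠ t in atTop, m₀ ≤ φ t) :
    Tendsto φ atTop (𝓝 κ) := by
  have hC : 0 ≤ ∫ s, K s τ0 := integral_nonneg fun s => H.kernel_nonneg s τ0
  obtain ⟨m, M, hm, hM, hφlt, hφgt, ⟨u, hu, hum⟩, ⟨w, hw, hwM⟩⟩ :=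
    exists_oscillation_bounds (hφm.mono fun t ht => ⟨ht, (hφζ t).2⟩)
  have hm0 : 0 < m := hm₀.trans_le hm
  obtain ⟨ψ, hψ, hψI, hψm⟩ := H.exists_limit_solution hφ (fun t => (hφζ t).1) (fun t => (hφζ t).2)
    hsol hφlt hφgt hu hum
  obtain ⟨ρ, hρ, hρI, hρM⟩ := H.exists_limit_solution hφ (fun t => (hφζ t).1) (fun t => (hφζ t).2)
    hsol hφlt hφgt hw hwM
  have hmM : m ≤ M := (hψI 0).1.trans (hψI 0).2
  have hcont : ContinuousOn (fun v => g v τ0) (Icc m M) :=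
    (H.continuousOn_nonlin τ0).mono fun v hv => hm0.le.trans hv.1
  obtain ⟨a, ha, hamin⟩ := isCompact_Icc.exists_isMinOn (nonempty_Icc.2 hmM) hcont
  obtain ⟨b, hb, hbmax⟩ := isCompact_Icc.exists_isMaxOn (nonempty_Icc.2 hmM) hcont
  have ha0 : 0 ≤ a := hm0.le.trans ha.1
  have hb0 : 0 ≤ b := hm0.le.trans hb.1
  have hGa : G a ≤ m := by
    refine (hΘ.le_iff_le (hG a ha0).1 ⟨hm0.le, hmM.trans hM⟩).1 ?_
    have := H.add_le_convOp hτ hτ1 hmono hψ hm0.le (fun t => (hψI t).1)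
      (fun t => hamin (hψI t)) 0
    simp only [(hG a ha0).2]
    linarith
  have hGb : M ≤ G b := by
    refine (hΘ.le_iff_le ⟨hm0.le.trans hmM, hM⟩ (hG b hb0).1).1 ?_
    have := H.convOp_le_add hτ hτ1 hmono hρ (fun t => ⟨hm0.le.trans (hρI t).1, (hρI t).2⟩)
      (fun t => hbmax (hρI t)) 0
    simp only [(hG b hb0).2]
    linarith
  have hGcont : ContinuousOn G (Icc 0 ζ) := hΘ.continuousOn_of_comp_eq
    (((H.continuousOn_nonlin τ0).mono Icc_subset_Ici_self).const_mul (∫ s, K s τ0))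
    (fun v hv => (hG v hv.1).1) fun v hv => (hG v hv.1).2
  obtain ⟨rfl, rfl⟩ := eq_of_le_map_of_attracting hd hGcont (fun x hx => (hG x hx.1).1) hd1 hd2
    hfix hattr hm0 hM ha hb hGa hGb
  exact tendsto_order.2 ⟨hφlt, hφgt⟩

end IsConvData

theorem stmt15
    {X : Type*} [MeasurableSpace X] (μ : Measure X) [IsFiniteMeasure μ]
    (K : ℝ → X → ℝ) (g : ℝ → X → ℝ)
    (hKmeas : Measurable fun p : ℝ × X => K p.1 p.2)
    (hKnn : ∀ s τ, 0 ≤ K s τ)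
    (hKint : Integrable (fun p : ℝ × X => K p.1 p.2) ((volume : Measure ℝ).prod μ))
    (hKpos : ∀ τ, 0 < ∫ s, K s τ)
    (hgmeas : Measurable fun p : ℝ × X => g p.1 p.2)
    (hg0 : ∀ τ, g 0 τ = 0)
    (hgnn : ∀ u τ, 0 ≤ u → 0 ≤ g u τ)
    (hgcont : ∀ τ, ContinuousOn (fun u => g u τ) (Ici 0))
    (g' : X → ℝ) (hg'meas : Measurable g') (hg'pos : ∀ τ, 0 < g' τ)
    (hg'lim : ∀ τ, Tendsto (fun u => g u τ / u) (𝓝[>] 0) (𝓝 (g' τ)))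
    (δ : ℝ) (hδ : 0 < δ)
    (hgbdd : ∃ B : ℝ, ∀ s τ, 0 < s → g s τ ≤ B)
    (hgpos : ∀ s τ, 0 < s → 0 < g s τ)
    (hlin : ∀ τ, ∀ s ∈ Icc (0:ℝ) δ, g s τ = g' τ * s)
    (hsub : ∀ τ, ∀ s, 0 ≤ s → g s τ ≤ g' τ * s)
    (τ0 : X) (hτ0 : μ {τ0} = 1)
    (hmono : ∀ τ, τ ≠ τ0 → MonotoneOn (fun v => g v τ) (Ici 0))
    (hgτ0 : ∀ v, 0 < v → 0 < g v τ0)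
    (S : ℝ) (hS : IsLUB ((fun v => g v τ0) '' Ici 0) S)
    (ζ2 : ℝ) (hζ2 : 0 < ζ2)
    (hΘmono : StrictMonoOn (fun v => v - ∫ τ in {τ0}ᶜ, (g v τ * ∫ s, K s τ) ∂μ) (Icc 0 ζ2))
    (hΘζ2 : (∫ s, K s τ0) * S < ζ2 - ∫ τ in {τ0}ᶜ, (g ζ2 τ * ∫ s, K s τ) ∂μ)
    (G : ℝ → ℝ)
    (hGdef : ∀ v, 0 ≤ v → G v ∈ Icc 0 ζ2 ∧
      G v - (∫ τ in {τ0}ᶜ, (g (G v) τ * ∫ s, K s τ) ∂μ) = (∫ s, K s τ0) * g v τ0)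
    (hχ0int : Integrable (fun p : ℝ × X => K p.1 p.2 * g' p.2) ((volume : Measure ℝ).prod μ))
    (hχ0 : 1 < ∫ τ, (∫ s, K s τ * g' τ) ∂μ)
    (lam : ℝ) (hlam : 0 < lam)
    (hlamint : Integrable (fun p : ℝ × X => K p.1 p.2 * g' p.2 * Real.exp (-(p.1 * lam))) ((volume : Measure ℝ).prod μ))
    (hlamzero : (∫ τ, (∫ s, K s τ * g' τ * Real.exp (-(s * lam))) ∂μ) = 1)
    (hleft : ∀ z ∈ Ioo (0:ℝ) lam, (Integrable (fun p : ℝ × X => K p.1 p.2 * g' p.2 * Real.exp (-(p.1 * z))) ((volume : Measure ℝ).prod μ)) → (∫ τ, (∫ s, K s τ * g' τ * Real.exp (-(s * z))) ∂μ) ≠ 1)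
    (ε : ℝ) (hε : 0 < ε)
    (hνint : Integrable (fun p : ℝ × X => K p.1 p.2 * g' p.2 * Real.exp (-(p.1 * (lam + ε)))) ((volume : Measure ℝ).prod μ))
    (hνpos : (∫ τ, (∫ s, K s τ * g' τ * Real.exp (-(s * (lam + ε)))) ∂μ) < 1) :
    ∃ φ : ℝ → ℝ, Continuous φ ∧ (∀ t, 0 ≤ φ t) ∧
      (∀ t, φ t = ∫ τ, (∫ s, K s τ * g (φ (t - s)) τ) ∂μ) ∧
      (∀ t : ℝ, t ≤ 0 → δ * Real.exp (lam * t) * (1 - Real.exp (ε * t)) ≤ φ t) ∧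
      (∀ t : ℝ, φ t ≤ δ * Real.exp (lam * t)) ∧
      Tendsto φ atBot (𝓝 0) ∧
      ((IntegrableOn (fun τ => g' τ * ∫ s, K s τ) {τ0}ᶜ μ ∧
          (∫ τ in {τ0}ᶜ, (g' τ * ∫ s, K s τ) ∂μ) < 1) →
        sSup (Set.range φ) < ζ2) ∧
      (∀ κ : ℝ, ((∀ s : ℝ, 0 ≤ s → (G s = s ↔ s = 0 ∨ s = κ)) ∧
          (∀ s ∈ Ioc (0:ℝ) ζ2, Tendsto (fun n => G^[n] s) atTop (𝓝 κ))) →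
        Tendsto φ atTop (𝓝 κ)) := by
  obtain ⟨B, hB⟩ := hgbdd
  have hB0 : 0 < B := (hgpos 1 τ0 one_pos).trans_le (hB 1 τ0 one_pos)
  have H : IsConvData μ K g B :=
    { measurable_kernel := hKmeas
      kernel_nonneg := hKnn
      integrable_kernel := hKint
      integrable_slice := fun τ => not_imp_comm.1 integral_undef (hKpos τ).ne'
      measurable_nonlin := hgmeas
      nonlin_nonneg := hgnn
      nonlin_le := fun u τ hu => by
        rcases hu.eq_or_lt with rfl | hu
        · rw [hg0]; exact hB0.le
        · exact hB u τ hu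
      continuousOn_nonlin := hgcont }
  set C := ∫ s, K s τ0 with hC
  have hC0 : 0 < C := hKpos τ0
  have hSle : ∀ v, 0 ≤ v → g v τ0 ≤ S := fun v hv => hS.1 ⟨v, hv, rfl⟩
  have hwint : Integrable (fun τ => g' τ * ∫ s, K s τ) μ :=
    hχ0int.integral_prod_right.congr (Eventually.of_forall fun τ => by
      simp only [integral_mul_const, mul_comm])
  have hw1 : 1 < ∫ τ, (g' τ * ∫ s, K s τ) ∂μ := by
    simpa only [integral_mul_const, mul_comm] using hχ0
  set p := ∫ τ in {τ0}ᶜ, (g' τ * ∫ s, K s τ) ∂μ with hp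
  set P : ℝ → ℝ := fun v => ∫ τ in {τ0}ᶜ, (g v τ * ∫ s, K s τ) ∂μ with hP
  have hPlin : ∀ v ∈ Icc 0 δ, P v = p * v := fun v hv => by
    simp only [hP, hp, hlin _ v hv]
    rw [← integral_mul_const]
    exact integral_congr_ae (Eventually.of_forall fun τ => by ring)
  have hp1 : p < 1 := by
    have hv : 0 < min δ ζ2 := lt_min hδ hζ2
    have h := hΘmono ⟨le_rfl, hζ2.le⟩ ⟨hv.le, min_le_right _ _⟩ hv
    have h' : 0 - P 0 < min δ ζ2 - P (min δ ζ2) := h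
    rw [hPlin 0 ⟨le_rfl, hδ.le⟩, hPlin _ ⟨hv.le, min_le_left _ _⟩] at h'
    nlinarith
  have hτ : MeasurableSet ({τ0} : Set X) := by
    by_contra h
    rw [hp, measure_restrict_compl_singleton_of_not_measurableSet μ h] at hp1
    exact hw1.not_gt hp1
  have hpq : 1 < p + g' τ0 * C := by
    rwa [integral_eq_setIntegral_compl_add_of_measure_singleton hτ hτ0 hwint] at hw1
  have hq0 : 0 < g' τ0 * C := mul_pos (hg'pos τ0) hC0
  have hδζ : δ < ζ2 := by
    by_contra! h
    have h1 : C * S < ζ2 - P ζ2 := hΘζ2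
    rw [hPlin ζ2 ⟨hζ2.le, h⟩] at h1
    have h2 := hSle ζ2 hζ2.le
    rw [hlin τ0 ζ2 ⟨hζ2.le, h⟩] at h2
    nlinarith [mul_le_mul_of_nonneg_left h2 hC0.le]
  have hmax : ∀ φ, Measurable φ → (∀ t, φ t ∈ Icc 0 ζ2) → ∀ t, convOp μ K g φ t ≤ P ζ2 + C * S :=
    fun φ hφ hφI t => H.convOp_le_add hτ hτ0 hmono hφ hφI (fun s => hSle _ (hφI s).1) t
  have hc0 : P ζ2 + C * S < ζ2 := by linarith
  obtain ⟨y, hy, hymin⟩ := (isCompact_Icc (a := δ) (b := ζ2)).exists_isMinOn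
    (nonempty_Icc.2 hδζ.le) ((hgcont τ0).mono fun v hv => hδ.le.trans hv.1)
  have hgy : 0 < g y τ0 := hgτ0 y (hδ.trans_le hy.1)
  have hlow : ∀ τ, ∀ v ≤ min δ (g y τ0 / g' τ0), ∀ w ∈ Icc 0 ζ2, v ≤ w → g' τ * v ≤ g w τ := by
    intro τ v hv w hw hvw
    rcases le_total v 0 with h | h
    · exact (mul_nonpos_of_nonneg_of_nonpos (hg'pos τ).le h).trans (hgnn w τ hw.1)
    have hvδ : v ∈ Icc 0 δ := ⟨h, hv.trans (min_le_left _ _)⟩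
    by_cases hττ : τ = τ0
    · subst hττ
      rcases le_total w δ with hwδ | hwδ
      · rw [hlin τ w ⟨hw.1, hwδ⟩]
        exact mul_le_mul_of_nonneg_left hvw (hg'pos τ).le
      · refine le_trans ?_ (hymin ⟨hwδ, hw.2⟩ : g y τ ≤ g w τ)
        rw [mul_comm, ← le_div_iff₀ (hg'pos τ)]
        exact hv.trans (min_le_right _ _)
    · rw [← hlin τ v hvδ]
      exact hmono τ hττ h hw.1 hvw
  obtain ⟨φ, hφc, hφζ, hsol, hφU, hφL, m₀, hm₀, hφm⟩ := H.exists_solution_of_exp_barriers hg'pos hδ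
    hlam hε hδζ (lt_min hδ (div_pos hgy (hg'pos τ0))) (min_le_left _ _) hlin hsub hlow
    (fun φ hφ hφI t => (hmax φ hφ hφI t).trans hc0.le) hlamint hlamzero hνint hνpos.le
  refine ⟨φ, hφc, fun t => (hφζ t).1, hsol, fun t _ => (Eq.le ?_).trans (hφL t), hφU, ?_, fun _ => ?_,
    fun κ hκ => ?_⟩
  · rw [one_mul, add_mul, Real.exp_add]; ring
  · refine squeeze_zero (fun t => (hφζ t).1) hφU ?_
    simpa using (Real.tendsto_exp_atBot.comp
      (tendsto_id.const_mul_atBot hlam)).const_mul δ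
  · refine lt_of_le_of_lt (csSup_le (range_nonempty φ) ?_) hc0
    rintro _ ⟨t, rfl⟩
    rw [hsol t]
    exact hmax φ hφc.measurable hφζ t
  · set θ := g' τ0 * C / (1 - p) with hθ
    have hp1' : 0 < 1 - p := sub_pos.2 hp1
    have hθ1 : 1 < θ := by rw [hθ, one_lt_div hp1']; linarith
    have hθ0 : 0 < θ := one_pos.trans hθ1
    have hGlin : ∀ x, 0 ≤ x → x ≤ δ / θ → G x = θ * x := fun x hx hxd => by
      have hxδ : θ * x ≤ δ := by rwa [le_div_iff₀ hθ0, mul_comm] at hxd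
      have hθx : θ * x ∈ Icc 0 δ := ⟨by positivity, hxδ⟩
      refine hΘmono.injOn (hGdef x hx).1 ⟨hθx.1, hxδ.trans hδζ.le⟩ ?_
      refine (hGdef x hx).2.trans ?_
      change C * g x τ0 = θ * x - P (θ * x)
      rw [hPlin _ hθx, hlin τ0 x ⟨hx, by nlinarith⟩, hθ]
      field_simp
    have hx1 : ∀ x, 0 < x → x < θ * x := fun x hx => by nlinarith
    have hd : δ / θ / θ ≤ δ / θ := div_le_self (by positivity) hθ1.le
    refine H.tendsto_atTop_of_attracting hτ hτ0 hmono hΘmono hGdef (d := δ / θ / θ) (by positivity)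
      (fun x hx hxd => ?_) (fun x hx hxd => ?_) hκ.1 hκ.2 hφc.measurable hφζ hsol hm₀ hφm
    · rw [hGlin x hx.le (hxd.trans hd)]
      exact hx1 x hx
    · rw [hGlin x hx.le (hxd.trans hd), hGlin (θ * x) (by positivity)
        (by rwa [le_div_iff₀ hθ0, mul_comm] at hxd)]
      exact (hx1 x hx).trans (hx1 _ (by positivity))
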